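/- Let X be a Polish space, p ≥ 1, μ ∈ P(X), ν ∈ P_p(ℝ^d), and let C : X × P_p(ℝ^d) → (−∞,∞] be lower semicontinuous, convex in its second argument, and satisfy the lower bound C(x,ρ) ≥ −(a_ℓ(x) + ∫ b_ℓ dρ) for some real-valued lower semicontinuous μ-integrable function a_ℓ : X → ℝ and some convex function b_ℓ ∈ C_{b,p}(ℝ^d). If C is decreasing in the convex order in its second argument, then inf_{π ∈ Π(μ,ν)} ∫_X C(x, π_x) dμ(x) = sup { ∫_X ψ^C dμ − ∫_{ℝ^d} ψ dν : ψ convex, ψ = φ + b_ℓ for some φ ∈ C_{b,p}(ℝ^d) }. -/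

import Mathlib

open MeasureTheory Set Filter Topology
open scoped ENNReal

noncomputable section

/-- `ℝ^d`, modelled as Euclidean space. -/
abbrev Rd (d : ℕ) : Type := EuclideanSpace ℝ (Fin d)

/-- A Borel measure on `ℝ^d` has finite `p`-th moment. -/
def HasMomentP (p : ℝ) {d : ℕ} (ρ : Measure (Rd d)) : Prop :=
  ∫⁻ y, ENNReal.ofReal (‖y‖ ^ p) ∂ρ ≠ ⊤

/-- `P_p(ℝ^d)`: Borel probability measures on `ℝ^d` with finite `p`-th moment. -/
abbrev Pp (p : ℝ) (d : ℕ) : Type :=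
  {ρ : Measure (Rd d) // IsProbabilityMeasure ρ ∧ HasMomentP p ρ}

/-- Continuous test functions of growth of order at most `p`. -/
def GrowthP (p : ℝ) {d : ℕ} (f : Rd d → ℝ) : Prop :=
  Continuous f ∧ ∃ K : ℝ, ∀ y, |f y| ≤ K * (1 + ‖y‖ ^ p)

/-- The `p`-weak topology on `P_p(ℝ^d)`: the initial topology induced by integration
against continuous functions of growth of order at most `p`. -/
instance PpTopology (p : ℝ) (d : ℕ) : TopologicalSpace (Pp p d) :=
  ⨅ f : {f : Rd d → ℝ // GrowthP p f},
    TopologicalSpace.induced (fun ρ : Pp p d => ∫ y, f.1 y ∂ρ.1) inferInstance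

instance PpMeasurableSpace (p : ℝ) (d : ℕ) : MeasurableSpace (Pp p d) := borel _

/-- `C_{b,p}(ℝ^d)`: continuous functions bounded from below by a constant and bounded
above by `K (1 + |y - y₀|^p)` for some `K > 0`, `y₀`. -/
def Cbp (p : ℝ) {d : ℕ} (ψ : Rd d → ℝ) : Prop :=
  Continuous ψ ∧ (∃ c : ℝ, ∀ y, c ≤ ψ y) ∧
    ∃ K : ℝ, 0 < K ∧ ∃ y₀ : Rd d, ∀ y, ψ y ≤ K * (1 + ‖y - y₀‖ ^ p)

open scoped Classical in
/-- The nonnegative part of an extended real, as an extended nonnegative real. -/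
def erealToENN (x : EReal) : ℝ≥0∞ := if x = ⊤ then ⊤ else ENNReal.ofReal x.toReal

/-- Canonical extended integral of an `EReal`-valued function: the lower integral of the
positive part minus the lower integral of the negative part. -/
def eInt {α : Type*} [MeasurableSpace α] (μ : Measure α) (f : α → EReal) : EReal :=
  ((∫⁻ x, erealToENN (f x) ∂μ : ℝ≥0∞) : EReal) -
    ((∫⁻ x, erealToENN (-(f x)) ∂μ : ℝ≥0∞) : EReal)

/-- The convex order on measures on `ℝ^d`: `ρ₁ ≼_c ρ₂` iff `∫ f dρ₁ ≤ ∫ f dρ₂` for every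
convex function `f : ℝ^d → ℝ` (integrals taken in the extended sense). -/
def ConvexOrder {d : ℕ} (ρ₁ ρ₂ : Measure (Rd d)) : Prop :=
  ∀ f : Rd d → ℝ, ConvexOn ℝ univ f →
    eInt ρ₁ (fun y => (f y : EReal)) ≤ eInt ρ₂ (fun y => (f y : EReal))

/-- Coordinatewise increasing functions on `ℝ^d`. -/
def CoordMono {d : ℕ} (f : Rd d → ℝ) : Prop :=
  ∀ y z : Rd d, (∀ i, y i ≤ z i) → f y ≤ f z

/-- The increasing convex order on measures on `ℝ^d`. -/
def IcxOrder {d : ℕ} (ρ₁ ρ₂ : Measure (Rd d)) : Prop :=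
  ∀ f : Rd d → ℝ, ConvexOn ℝ univ f → CoordMono f →
    eInt ρ₁ (fun y => (f y : EReal)) ≤ eInt ρ₂ (fun y => (f y : EReal))

/-- `π` is a coupling of `μ` and `ν`. -/
def IsCoupling {X Y : Type*} [MeasurableSpace X] [MeasurableSpace Y]
    (π : Measure (X × Y)) (μ : Measure X) (ν : Measure Y) : Prop :=
  IsProbabilityMeasure π ∧ π.map Prod.fst = μ ∧ π.map Prod.snd = ν

open scoped Classical in
/-- Disintegration of a measure on a product space with respect to its first marginal. -/
def disint {X : Type*} [MeasurableSpace X] {Y : Type*} [MeasurableSpace Y]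
    [StandardBorelSpace Y] [Nonempty Y] (π : Measure (X × Y)) :
    ProbabilityTheory.Kernel X Y :=
  if h : IsFiniteMeasure π then (haveI := h; π.condKernel) else 0

/-- The primal weak optimal transport value `inf_{π ∈ Π(μ,ν)} ∫ C(x, π_x) dμ(x)`. -/
def primal {X : Type*} [MeasurableSpace X] {d : ℕ}
    (μ : Measure X) (ν : Measure (Rd d)) (C : X → Measure (Rd d) → ℝ≥0∞) : ℝ≥0∞ :=
  ⨅ π : {π : Measure (X × Rd d) // IsCoupling π μ ν}, ∫⁻ x, C x (disint π.1 x) ∂μ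

/-- The `C`-conjugate `ψ^C (x) = inf_{ρ ∈ P_p} ρ(ψ) + C(x, ρ)`. -/
def conj (p : ℝ) {X : Type*} [MeasurableSpace X] {d : ℕ}
    (C : X → Measure (Rd d) → ℝ≥0∞) (ψ : Rd d → ℝ) (x : X) : EReal :=
  ⨅ ρ : Pp p d, ((∫ y, ψ y ∂ρ.1 : ℝ) : EReal) + ((C x ρ.1 : ℝ≥0∞) : EReal)

/-- The dual value `μ(ψ^C) - ν(ψ)`. -/
def dualVal (p : ℝ) {X : Type*} [MeasurableSpace X] {d : ℕ}
    (μ : Measure X) (ν : Measure (Rd d)) (C : X → Measure (Rd d) → ℝ≥0∞)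
    (ψ : Rd d → ℝ) : EReal :=
  eInt μ (conj p C ψ) - ((∫ y, ψ y ∂ν : ℝ) : EReal)

end

noncomputable section

/-- The `C`-conjugate for an extended-real-valued cost. -/
def eConj (p : ℝ) {X : Type*} [MeasurableSpace X] {d : ℕ}
    (C : X → Measure (Rd d) → EReal) (ψ : Rd d → ℝ) (x : X) : EReal :=
  ⨅ ρ : Pp p d, ((∫ y, ψ y ∂ρ.1 : ℝ) : EReal) + C x ρ.1

/-- The primal weak transport value for an extended-real-valued cost. -/
def eprimal {X : Type*} [MeasurableSpace X] {d : ℕ}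
    (μ : Measure X) (ν : Measure (Rd d)) (C : X → Measure (Rd d) → EReal) : EReal :=
  ⨅ π : {π : Measure (X × Rd d) // IsCoupling π μ ν},
    eInt μ (fun x => C x (disint π.1 x))

end

theorem exists_subset_of_iInter_subset_open {σ : ℕ → ℕ} {V : Set (ℕ → ℕ)} (hV : IsOpen V)
    (h : {τ : ℕ → ℕ | ∀ i, τ i ≤ σ i} ⊆ V) : ∃ n, {τ : ℕ → ℕ | ∀ i < n, τ i ≤ σ i} ⊆ V := by
  by_contra! hcon
  simp only [Set.not_subset, mem_ofPred_eq] at hcon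
  choose τ hτ hτV using hcon
  let b : ℕ → ℕ := fun i => σ i + ∑ n ∈ Finset.range (i + 1), τ n i
  have hQ : IsCompact (Set.pi univ fun i => Set.Iic (b i)) :=
    isCompact_univ_pi fun i => (Set.finite_Iic (b i)).isCompact
  have hmem : ∀ n, τ n ∈ Set.pi univ fun i => Set.Iic (b i) := by
    intro n i _
    by_cases hin : i < n
    · exact (hτ n i hin).trans (Nat.le_add_right _ _)
    · have : τ n i ≤ ∑ m ∈ Finset.range (i + 1), τ m i :=
        Finset.single_le_sum (f := fun m => τ m i) (fun _ _ => Nat.zero_le _)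
          (Finset.mem_range.2 (by omega))
      exact this.trans (Nat.le_add_left _ _)
  obtain ⟨t, -, φ, hφ, ht⟩ := hQ.tendsto_subseq hmem
  have htV : t ∈ Vᶜ := hV.isClosed_compl.mem_of_tendsto ht (Eventually.of_forall fun n => hτV _)
  refine htV (h fun i => ?_)
  have hti := (continuous_apply i).continuousAt.tendsto.comp ht
  refine le_of_tendsto hti ?_
  filter_upwards [eventually_gt_atTop i] with n hn
  exact hτ _ i (hn.trans_le hφ.le_apply)

/-- Analytic sets are inner regular with respect to compact sets. -/
theorem MeasureTheory.AnalyticSet.exists_isCompact_measure_le_add {α : Type*} [TopologicalSpace α]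
    [T2Space α] [MeasurableSpace α] [BorelSpace α] {s : Set α} (hs : AnalyticSet s)
    (μ : Measure α) [IsFiniteMeasure μ] {ε : ℝ≥0∞} (hε : ε ≠ 0) :
    ∃ K ⊆ s, IsCompact K ∧ μ s ≤ μ K + ε := by
  rw [AnalyticSet] at hs
  rcases hs with rfl | ⟨f, hf, rfl⟩
  · exact ⟨∅, subset_rfl, isCompact_empty, by simp⟩
  obtain ⟨δ, hδ0, hδ⟩ := ENNReal.exists_pos_sum_of_countable' hε ℕ
  have step : ∀ (A : Set (ℕ → ℕ)) (n : ℕ),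
      ∃ k : ℕ, μ (f '' A) ≤ μ (f '' (A ∩ {τ | τ n ≤ k})) + δ n := by
    intro A n
    have hU : f '' A = ⋃ k : ℕ, f '' (A ∩ {τ | τ n ≤ k}) := by
      rw [← image_iUnion, ← inter_iUnion]
      congr 1
      refine (inter_eq_left.2 fun τ _ => mem_iUnion.2 ⟨τ n, le_refl (τ n)⟩).symm
    have hmono : Monotone fun k : ℕ => f '' (A ∩ {τ | τ n ≤ k}) := fun a b hab =>
      image_mono (inter_subset_inter_right _ fun τ (h : τ n ≤ a) => h.trans hab)
    have hsup : μ (f '' A) = ⨆ k : ℕ, μ (f '' (A ∩ {τ | τ n ≤ k})) := by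
      conv_lhs => rw [hU]
      exact hmono.measure_iUnion
    by_cases h0 : μ (f '' A) = 0
    · exact ⟨0, by simp [h0]⟩
    have hlt : μ (f '' A) - δ n < ⨆ k : ℕ, μ (f '' (A ∩ {τ | τ n ≤ k})) := by
      rw [← hsup]
      exact ENNReal.sub_lt_self (measure_ne_top _ _) h0 (hδ0 n).ne'
    obtain ⟨k, hk⟩ := lt_iSup_iff.1 hlt
    exact ⟨k, tsub_le_iff_right.1 hk.le⟩
  choose g hg using step
  let A : ℕ → Set (ℕ → ℕ) := fun n =>
    Nat.rec univ (fun n B => B ∩ {τ | τ n ≤ g B n}) n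
  have hAsucc : ∀ n, A (n + 1) = A n ∩ {τ | τ n ≤ g (A n) n} := fun _ => rfl
  let σ : ℕ → ℕ := fun n => g (A n) n
  have hA : ∀ n, A n = {τ | ∀ i < n, τ i ≤ σ i} := by
    intro n
    induction n with
    | zero => ext τ; simp [A]
    | succ n ih =>
      rw [hAsucc, ih]
      ext τ
      simp only [mem_inter_iff, mem_ofPred_eq, Nat.lt_succ_iff_lt_or_eq]
      rw [← ih]
      exact ⟨fun h i hi => hi.elim (h.1 i) fun e => e ▸ h.2,
        fun h => ⟨fun i hi => h i (Or.inl hi), h n (Or.inr rfl)⟩⟩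
  have hmeas : ∀ n, μ (range f) ≤ μ (f '' A n) + ∑ i ∈ Finset.range n, δ i := by
    intro n
    induction n with
    | zero => simp [A]
    | succ n ih =>
      refine ih.trans ?_
      rw [Finset.sum_range_succ, add_comm (∑ i ∈ Finset.range n, δ i), ← add_assoc]
      gcongr
      rw [hAsucc]
      exact hg _ _
  let P : Set (ℕ → ℕ) := {τ | ∀ i, τ i ≤ σ i}
  have hP : IsCompact P := by
    have : P = Set.pi univ fun i => Set.Iic (σ i) := by ext; simp [P, Pi.le_def]
    rw [this]
    exact isCompact_univ_pi fun i => (Set.finite_Iic (σ i)).isCompact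
  have hK : IsCompact (f '' P) := hP.image hf
  refine ⟨f '' P, image_subset_range _ _, hK, ?_⟩
  have hsub : ⋂ n, closure (f '' A n) ⊆ f '' P := by
    intro y hy
    by_contra hyK
    obtain ⟨U, V, hU, hV, hKU, hyV, hUV⟩ :=
      SeparatedNhds.of_isCompact_isCompact hK isCompact_singleton
        (disjoint_singleton_right.2 hyK)
    obtain ⟨n, hn⟩ := exists_subset_of_iInter_subset_open (hU.preimage hf) (image_subset_iff.1 hKU)
    rw [← hA] at hn
    obtain ⟨z, hzV, hz⟩ := mem_closure_iff.1 (mem_iInter.1 hy n) V hV (hyV rfl)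
    exact disjoint_left.1 hUV (image_subset_iff.2 hn hz) hzV
  have hanti : Antitone fun n => closure (f '' A n) := by
    refine antitone_nat_of_succ_le fun n => closure_mono (image_mono ?_)
    rw [hAsucc]
    exact inter_subset_left
  have hlim := tendsto_measure_iInter_atTop (μ := μ)
    (fun n => (isClosed_closure (s := f '' A n)).measurableSet.nullMeasurableSet) hanti
    ⟨0, measure_ne_top _ _⟩
  have hle : μ (range f) ≤ μ (⋂ n, closure (f '' A n)) + ε := by
    refine ge_of_tendsto' (hlim.add_const ε) fun n => (hmeas n).trans ?_
    exact add_le_add (measure_mono subset_closure) ((ENNReal.sum_le_tsum _).trans hδ.le)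
  refine hle.trans ?_
  gcongr

/-- Analytic sets are universally measurable. -/
theorem MeasureTheory.AnalyticSet.nullMeasurableSet {α : Type*} [TopologicalSpace α]
    [T2Space α] [MeasurableSpace α] [BorelSpace α] {s : Set α} (hs : AnalyticSet s)
    (μ : Measure α) [IsFiniteMeasure μ] : NullMeasurableSet s μ := by
  have h : ∀ n : ℕ, ∃ K ⊆ s, IsCompact K ∧ μ s ≤ μ K + (n : ℝ≥0∞)⁻¹ := fun n =>
    hs.exists_isCompact_measure_le_add μ (by simp)
  choose K hKs hKc hK using h
  have hB : MeasurableSet (⋃ n, K n) :=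
    MeasurableSet.iUnion fun n => (hKc n).isClosed.measurableSet
  have hBs : ⋃ n, K n ⊆ s := iUnion_subset hKs
  have hle : μ s ≤ μ (⋃ n, K n) := by
    have hlim : Tendsto (fun n : ℕ => μ (⋃ n, K n) + (n : ℝ≥0∞)⁻¹) atTop
        (𝓝 (μ (⋃ n, K n) + 0)) := ENNReal.tendsto_inv_nat_nhds_zero.const_add _
    rw [add_zero] at hlim
    refine ge_of_tendsto' hlim fun n => (hK n).trans ?_
    gcongr
    exact subset_iUnion K n
  refine hB.nullMeasurableSet.congr ?_
  have h1 : (⋃ n, K n : Set α) =ᵐ[μ] toMeasurable μ s :=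
    ae_eq_of_subset_of_measure_ge (hBs.trans (subset_toMeasurable μ s))
      (by rwa [measure_toMeasurable]) hB.nullMeasurableSet (measure_ne_top _ _)
  refine (LE.le.eventuallyLE hBs).antisymm ?_
  exact (LE.le.eventuallyLE (subset_toMeasurable μ s)).trans h1.symm.le

section GrowthClasses

variable {p : ℝ} {d : ℕ}

theorem growthP_iff (f : Rd d → ℝ) :
    GrowthP p f ↔ Continuous f ∧ ∃ K : ℝ, 0 ≤ K ∧ ∀ y, |f y| ≤ K * (1 + ‖y‖ ^ p) := by
  refine and_congr_right fun _ => ⟨fun ⟨K, hK⟩ => ⟨max K 0, le_max_right _ _, fun y => ?_⟩,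
    fun ⟨K, _, hK⟩ => ⟨K, hK⟩⟩
  have : 0 ≤ ‖y‖ ^ p := Real.rpow_nonneg (norm_nonneg _) _
  exact (hK y).trans (mul_le_mul_of_nonneg_right (le_max_left _ _) (by linarith))

theorem one_le_weight (p : ℝ) (y : Rd d) : 1 ≤ 1 + ‖y‖ ^ p :=
  le_add_of_nonneg_right (Real.rpow_nonneg (norm_nonneg _) _)

theorem weight_add_le (hp : 0 ≤ p) (y z : Rd d) :
    1 + ‖y + z‖ ^ p ≤ (2 ^ p * (1 + ‖z‖ ^ p) + 1) * (1 + ‖y‖ ^ p) := by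
  have hy : 0 ≤ ‖y‖ ^ p := Real.rpow_nonneg (norm_nonneg _) _
  have hz : 0 ≤ ‖z‖ ^ p := Real.rpow_nonneg (norm_nonneg _) _
  have h2 : (0 : ℝ) ≤ 2 ^ p := Real.rpow_nonneg zero_le_two _
  have h1 : ‖y + z‖ ^ p ≤ 2 ^ p * (‖y‖ ^ p + ‖z‖ ^ p) := by
    have hmax : ‖y + z‖ ≤ 2 * max ‖y‖ ‖z‖ := by
      have := norm_add_le y z
      linarith [le_max_left ‖y‖ ‖z‖, le_max_right ‖y‖ ‖z‖]
    refine (Real.rpow_le_rpow (norm_nonneg _) hmax hp).trans ?_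
    rw [Real.mul_rpow zero_le_two (le_max_of_le_left (norm_nonneg _))]
    refine mul_le_mul_of_nonneg_left ?_ h2
    rcases max_cases ‖y‖ ‖z‖ with h | h <;> rw [h.1] <;> linarith
  nlinarith [mul_nonneg h2 hy, mul_nonneg h2 hz, mul_nonneg (mul_nonneg h2 hz) hy]

theorem continuous_weight (hp : 0 ≤ p) : Continuous fun y : Rd d => 1 + ‖y‖ ^ p :=
  continuous_const.add (continuous_norm.rpow_const fun _ => Or.inr hp)

theorem growthP_weight (hp : 0 ≤ p) : GrowthP p fun y : Rd d => 1 + ‖y‖ ^ p :=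
  ⟨continuous_weight hp, 1, fun y => by
    rw [one_mul, abs_of_nonneg (zero_le_one.trans (one_le_weight p y))]⟩

theorem GrowthP.add {f g : Rd d → ℝ} (hf : GrowthP p f) (hg : GrowthP p g) :
    GrowthP p fun y => f y + g y := by
  obtain ⟨hfc, K, hK⟩ := hf
  obtain ⟨hgc, M, hM⟩ := hg
  refine ⟨hfc.add hgc, K + M, fun y => (abs_add_le _ _).trans ?_⟩
  rw [add_mul]
  exact add_le_add (hK y) (hM y)

theorem GrowthP.const_mul {f : Rd d → ℝ} (hf : GrowthP p f) (c : ℝ) :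
    GrowthP p fun y => c * f y := by
  obtain ⟨hfc, K, hK⟩ := hf
  refine ⟨hfc.const_mul c, |c| * K, fun y => ?_⟩
  rw [abs_mul, mul_assoc]
  exact mul_le_mul_of_nonneg_left (hK y) (abs_nonneg c)

theorem growthP_const (c : ℝ) : GrowthP p fun _ : Rd d => c :=
  ⟨continuous_const, |c|, fun y => le_mul_of_one_le_right (abs_nonneg c) (one_le_weight p y)⟩

theorem GrowthP.sum {ι : Type*} (s : Finset ι) {f : ι → Rd d → ℝ} (hf : ∀ i ∈ s, GrowthP p (f i)) :
    GrowthP p fun y => ∑ i ∈ s, f i y := by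
  classical
  induction s using Finset.induction_on with
  | empty => simpa using growthP_const (p := p) (d := d) 0
  | insert a s ha ih =>
    simp only [Finset.sum_insert ha]
    exact (hf a (Finset.mem_insert_self _ _)).add
      (ih fun i hi => hf i (Finset.mem_insert_of_mem hi))

theorem Cbp.growthP (hp : 0 ≤ p) {ψ : Rd d → ℝ} (hψ : Cbp p ψ) : GrowthP p ψ := by
  obtain ⟨hc, ⟨c, hc'⟩, K, hK, y₀, h⟩ := hψ
  refine ⟨hc, |c| + K * (2 ^ p * (1 + ‖-y₀‖ ^ p) + 1), fun y => ?_⟩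
  have h1 := weight_add_le hp y (-y₀)
  have h2 := one_le_weight p y
  have h3 : 0 ≤ ‖-y₀‖ ^ p := Real.rpow_nonneg (norm_nonneg _) _
  have h4 : 0 ≤ |c| * ((1 + ‖y‖ ^ p) - 1) := mul_nonneg (abs_nonneg c) (by linarith)
  have h5 := mul_le_mul_of_nonneg_left h1 hK.le
  have h6 : 0 ≤ (2 : ℝ) ^ p := Real.rpow_nonneg zero_le_two _
  have h7 := h y
  rw [sub_eq_add_neg] at h7
  rw [abs_le]
  constructor
  · have h8 : 0 ≤ K * (2 ^ p * (1 + ‖-y₀‖ ^ p) + 1) * (1 + ‖y‖ ^ p) := by positivity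
    nlinarith [hc' y, neg_abs_le c]
  · nlinarith [abs_nonneg c]

theorem GrowthP.cbp {ψ : Rd d → ℝ} (hψ : GrowthP p ψ) {c : ℝ} (hc : ∀ y, c ≤ ψ y) : Cbp p ψ := by
  obtain ⟨h, K, hK0, hK⟩ := (growthP_iff ψ).1 hψ
  refine ⟨h, ⟨c, hc⟩, K + 1, by linarith, 0, fun y => ?_⟩
  rw [sub_zero]
  have := one_le_weight p y
  nlinarith [(le_abs_self _).trans (hK y)]

theorem cbp_weight (hp : 0 ≤ p) : Cbp p fun y : Rd d => 1 + ‖y‖ ^ p :=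
  (growthP_weight hp).cbp (one_le_weight p)

theorem cbp_const (c : ℝ) : Cbp p fun _ : Rd d => c :=
  (growthP_const c).cbp fun _ => le_rfl

theorem Cbp.add (hp : 0 ≤ p) {f g : Rd d → ℝ} (hf : Cbp p f) (hg : Cbp p g) :
    Cbp p fun y => f y + g y := by
  obtain ⟨c, hc⟩ := hf.2.1
  obtain ⟨c', hc'⟩ := hg.2.1
  exact ((hf.growthP hp).add (hg.growthP hp)).cbp fun y => add_le_add (hc y) (hc' y)

theorem Cbp.const_mul (hp : 0 ≤ p) {f : Rd d → ℝ} (hf : Cbp p f) {r : ℝ} (hr : 0 ≤ r) :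
    Cbp p fun y => r * f y := by
  obtain ⟨c, hc⟩ := hf.2.1
  exact ((hf.growthP hp).const_mul r).cbp fun y => mul_le_mul_of_nonneg_left (hc y) hr

end GrowthClasses

section Moments

variable {p : ℝ} {d : ℕ}

theorem HasMomentP.integrable_weight (hp : 0 ≤ p) {ρ : Measure (Rd d)} [IsFiniteMeasure ρ]
    (hρ : HasMomentP p ρ) : Integrable (fun y : Rd d => 1 + ‖y‖ ^ p) ρ := by
  refine (integrable_const _).add ⟨?_, ?_⟩
  · exact (continuous_norm.rpow_const fun _ => Or.inr hp).aestronglyMeasurable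
  · rw [hasFiniteIntegral_iff_ofReal (Eventually.of_forall fun y =>
      Real.rpow_nonneg (norm_nonneg _) _)]
    exact hρ.lt_top

theorem GrowthP.integrable (hp : 0 ≤ p) {ρ : Measure (Rd d)} [IsFiniteMeasure ρ]
    (hρ : HasMomentP p ρ) {f : Rd d → ℝ} (hf : GrowthP p f) : Integrable f ρ := by
  obtain ⟨hc, K, hK⟩ := hf
  exact ((hρ.integrable_weight hp).const_mul K).mono' hc.aestronglyMeasurable
    (Eventually.of_forall hK)

instance (ρ : Pp p d) : IsProbabilityMeasure ρ.1 := ρ.2.1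

theorem GrowthP.integrable_pp (hp : 0 ≤ p) {f : Rd d → ℝ} (hf : GrowthP p f) (ρ : Pp p d) :
    Integrable f ρ.1 := hf.integrable hp ρ.2.2

theorem GrowthP.continuous_integral {f : Rd d → ℝ} (hf : GrowthP p f) :
    Continuous fun ρ : Pp p d => ∫ y, f y ∂ρ.1 :=
  continuous_iInf_dom (i := ⟨f, hf⟩) continuous_induced_dom

/-- Mixtures of measures in `P_p`. -/
theorem Pp.mix_mem (ρ₁ ρ₂ : Pp p d) {t : ℝ} (h0 : 0 ≤ t) (h1 : t ≤ 1) :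
    IsProbabilityMeasure (ENNReal.ofReal t • ρ₁.1 + ENNReal.ofReal (1 - t) • ρ₂.1) ∧
      HasMomentP p (ENNReal.ofReal t • ρ₁.1 + ENNReal.ofReal (1 - t) • ρ₂.1) := by
  constructor
  · constructor
    simp only [Measure.coe_add, Measure.coe_smul, Pi.add_apply, Pi.smul_apply, measure_univ,
      smul_eq_mul, mul_one]
    rw [← ENNReal.ofReal_add h0 (by linarith)]
    simp
  · rw [HasMomentP, lintegral_add_measure, lintegral_smul_measure, lintegral_smul_measure]
    exact ENNReal.add_ne_top.2 ⟨ENNReal.mul_ne_top ENNReal.ofReal_ne_top ρ₁.2.2,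
      ENNReal.mul_ne_top ENNReal.ofReal_ne_top ρ₂.2.2⟩

theorem Pp.integral_mix {ρ₁ ρ₂ : Measure (Rd d)} {t : ℝ} (h0 : 0 ≤ t) (h1 : t ≤ 1)
    {f : Rd d → ℝ} (hf₁ : Integrable f ρ₁) (hf₂ : Integrable f ρ₂) :
    ∫ y, f y ∂(ENNReal.ofReal t • ρ₁ + ENNReal.ofReal (1 - t) • ρ₂) =
      t * ∫ y, f y ∂ρ₁ + (1 - t) * ∫ y, f y ∂ρ₂ := by
  rw [integral_add_measure (hf₁.smul_measure ENNReal.ofReal_ne_top)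
    (hf₂.smul_measure ENNReal.ofReal_ne_top), integral_smul_measure, integral_smul_measure,
    ENNReal.toReal_ofReal h0, ENNReal.toReal_ofReal (by linarith), smul_eq_mul, smul_eq_mul]

end Moments

section Law

variable {p : ℝ} {d : ℕ}

/-- The `L^p` space of `ℝ^d`-valued random variables on the unit interval. -/
abbrev LpRd (p : ℝ) (d : ℕ) : Type :=
  Lp (Rd d) (ENNReal.ofReal p) (volume : Measure unitInterval)

theorem LpRd.integrable_norm_rpow (hp : 1 ≤ p) (u : LpRd p d) :
    Integrable (fun ω => ‖u ω‖ ^ p) volume := by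
  have h := (Lp.memLp u).integrable_norm_rpow (by simp; linarith) ENNReal.ofReal_ne_top
  rwa [ENNReal.toReal_ofReal (by linarith)] at h

/-- The law of an `L^p` random variable, as an element of `P_p`. -/
noncomputable def lawPp (hp : 1 ≤ p) (u : LpRd p d) : Pp p d :=
  ⟨volume.map u, Measure.isProbabilityMeasure_map (Lp.aestronglyMeasurable u).aemeasurable, by
    have hm : Measurable fun y : Rd d => ENNReal.ofReal (‖y‖ ^ p) :=
      (continuous_norm.rpow_const fun _ => Or.inr (by linarith)).measurable.ennreal_ofReal
    rw [HasMomentP, lintegral_map' hm.aemeasurable (Lp.aestronglyMeasurable u).aemeasurable]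
    have h := (LpRd.integrable_norm_rpow hp u).2
    rw [hasFiniteIntegral_iff_ofReal (Eventually.of_forall fun y =>
      Real.rpow_nonneg (norm_nonneg _) _)] at h
    exact h.ne⟩

theorem surjective_lawPp (hp : 1 ≤ p) : Function.Surjective (lawPp (d := d) hp) := by
  intro ρ
  obtain ⟨f, hf, hfρ⟩ := ρ.1.exists_measurable_map_eq
  have hm : Measurable fun y : Rd d => ENNReal.ofReal (‖y‖ ^ p) :=
    (continuous_norm.rpow_const fun _ => Or.inr (by linarith)).measurable.ennreal_ofReal
  have hL : MemLp f (ENNReal.ofReal p) volume := by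
    rw [← integrable_norm_rpow_iff hf.aestronglyMeasurable (by simp; linarith)
      ENNReal.ofReal_ne_top, ENNReal.toReal_ofReal (by linarith)]
    refine ⟨((continuous_norm.rpow_const fun _ =>
      Or.inr (by linarith)).measurable.comp hf).aestronglyMeasurable, ?_⟩
    rw [hasFiniteIntegral_iff_ofReal (Eventually.of_forall fun y =>
      Real.rpow_nonneg (norm_nonneg _) _)]
    have h := ρ.2.2
    rw [HasMomentP, ← hfρ, lintegral_map hm hf] at h
    exact h.lt_top
  refine ⟨hL.toLp f, Subtype.ext ?_⟩
  exact (Measure.map_congr hL.coeFn_toLp).trans hfρ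

theorem lowerSemicontinuous_lintegral_Lp [Fact (1 ≤ ENNReal.ofReal p)] {h : Rd d → ℝ}
    (hc : Continuous h) :
    LowerSemicontinuous fun u : LpRd p d => ∫⁻ ω, ENNReal.ofReal (h (u ω)) := by
  intro u a ha
  by_contra hcon
  have hfreq : ∃ᶠ v in 𝓝 u, ∫⁻ ω, ENNReal.ofReal (h (v ω)) ≤ a := by
    exact fun h => hcon (h.mono fun v hv => not_le.1 hv)
  obtain ⟨v, hv, hva⟩ := exists_seq_forall_of_frequently hfreq
  have hLp : Tendsto (fun n => eLpNorm (⇑(v n) - ⇑u) (ENNReal.ofReal p) volume) atTop (𝓝 0) :=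
    (Lp.tendsto_Lp_iff_tendsto_eLpNorm' v u).1 hv
  have hp0 : ENNReal.ofReal p ≠ 0 :=
    (zero_lt_one.trans_le (Fact.out : 1 ≤ ENNReal.ofReal p)).ne'
  have hmeas := tendstoInMeasure_of_tendsto_eLpNorm hp0
    (fun n => Lp.aestronglyMeasurable (v n)) (Lp.aestronglyMeasurable u) hLp
  obtain ⟨ns, -, hns⟩ := hmeas.exists_seq_tendsto_ae
  have hfatou : ∫⁻ ω, ENNReal.ofReal (h (u ω)) ≤
      liminf (fun n => ∫⁻ ω, ENNReal.ofReal (h (v (ns n) ω))) atTop := by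
    refine le_trans (lintegral_mono_ae ?_) (lintegral_liminf_le' fun n => ?_)
    · filter_upwards [hns] with ω hω
      have := (ENNReal.continuous_ofReal.comp hc).continuousAt.tendsto.comp hω
      exact this.liminf_eq.ge
    · exact (hc.comp_aestronglyMeasurable
        (Lp.aestronglyMeasurable (v (ns n)))).aemeasurable.ennreal_ofReal
  refine not_le.2 ha (hfatou.trans ?_)
  refine (liminf_le_liminf (Eventually.of_forall fun n => hva (ns n))).trans ?_
  simp

theorem integral_lawPp (hp : 1 ≤ p) (u : LpRd p d) {f : Rd d → ℝ} (hf : Continuous f) :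
    ∫ y, f y ∂(lawPp hp u).1 = ∫ ω, f (u ω) :=
  integral_map (Lp.aestronglyMeasurable u).aemeasurable hf.aestronglyMeasurable

theorem GrowthP.integrable_comp_Lp (hp : 1 ≤ p) {f : Rd d → ℝ} (hf : GrowthP p f) (u : LpRd p d) :
    Integrable (fun ω => f (u ω)) volume :=
  (integrable_map_measure hf.1.aestronglyMeasurable
    (Lp.aestronglyMeasurable u).aemeasurable).1
    (hf.integrable_pp (by linarith) (lawPp hp u))

theorem lowerSemicontinuous_integral_Lp (hp : 1 ≤ p) [Fact (1 ≤ ENNReal.ofReal p)] {h : Rd d → ℝ}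
    (hh : GrowthP p h) (h0 : ∀ y, 0 ≤ h y) :
    LowerSemicontinuous fun u : LpRd p d => ∫ ω, h (u ω) := by
  intro u a ha
  rcases lt_or_ge a 0 with ha0 | ha0
  · exact Eventually.of_forall fun v => ha0.trans_le (integral_nonneg fun ω => h0 _)
  have key : ∀ v : LpRd p d, a < ∫ ω, h (v ω) ↔
      ENNReal.ofReal a < ∫⁻ ω, ENNReal.ofReal (h (v ω)) := by
    intro v
    rw [← ofReal_integral_eq_lintegral_ofReal (hh.integrable_comp_Lp hp v)
      (Eventually.of_forall fun ω => h0 _), ENNReal.ofReal_lt_ofReal_iff_of_nonneg ha0]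
  filter_upwards [lowerSemicontinuous_lintegral_Lp hh.1 u _ ((key u).1 ha)] with v hv
  exact (key v).2 hv

theorem continuous_integral_norm_rpow_Lp (hp : 1 ≤ p) [Fact (1 ≤ ENNReal.ofReal p)] :
    Continuous fun u : LpRd p d => ∫ ω, ‖u ω‖ ^ p := by
  have h : (fun u : LpRd p d => ∫ ω, ‖u ω‖ ^ p) = fun u => ‖u‖ ^ p := by
    ext u
    have hp0 : (0 : ℝ) < p := by linarith
    rw [Lp.norm_def, (Lp.memLp u).eLpNorm_eq_integral_rpow_norm (by simp; linarith)
      ENNReal.ofReal_ne_top, ENNReal.toReal_ofReal hp0.le]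
    have h0 : 0 ≤ ∫ ω, ‖u ω‖ ^ p := integral_nonneg fun ω => Real.rpow_nonneg (norm_nonneg _) _
    rw [ENNReal.toReal_ofReal (Real.rpow_nonneg h0 _), ← Real.rpow_mul h0,
      inv_mul_cancel₀ hp0.ne', Real.rpow_one]
  rw [h]
  exact continuous_norm.rpow_const fun _ => Or.inr (by linarith)

theorem continuous_lawPp (hp : 1 ≤ p) [Fact (1 ≤ ENNReal.ofReal p)] :
    Continuous (lawPp (d := d) hp) := by
  refine continuous_iInf_rng.2 fun f => continuous_induced_rng.2 ?_
  obtain ⟨f, hf⟩ := f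
  change Continuous fun u : LpRd p d => ∫ y, f y ∂(lawPp hp u).1
  simp_rw [integral_lawPp hp _ hf.1]
  obtain ⟨-, K, hK0, hK⟩ := (growthP_iff f).1 hf
  have hp0 : 0 ≤ p := by linarith
  have hw : GrowthP p fun y : Rd d => K * (1 + ‖y‖ ^ p) := (growthP_weight hp0).const_mul K
  have hW : Continuous fun u : LpRd p d => ∫ ω, K * (1 + ‖u ω‖ ^ p) := by
    have : (fun u : LpRd p d => ∫ ω, K * (1 + ‖u ω‖ ^ p)) =
        fun u => K * (1 + ∫ ω, ‖u ω‖ ^ p) := by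
      ext u
      rw [integral_const_mul, integral_add (integrable_const _) (LpRd.integrable_norm_rpow hp u)]
      simp
    rw [this]
    exact (continuous_const.add (continuous_integral_norm_rpow_Lp hp)).const_mul K
  have hadd := lowerSemicontinuous_integral_Lp hp (hw.add hf) fun y => by
    linarith [neg_abs_le (f y), hK y]
  have hsub := lowerSemicontinuous_integral_Lp hp (hw.add (hf.const_mul (-1))) fun y => by
    linarith [le_abs_self (f y), hK y]
  have hWc : ∀ c : ℝ, Continuous fun u : LpRd p d => c * ∫ ω, K * (1 + ‖u ω‖ ^ p) :=
    fun c => hW.const_mul c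
  refine continuous_iff_lower_upperSemicontinuous.2 ⟨?_, fun u a ha => ?_⟩
  · have := hadd.add (hWc (-1)).lowerSemicontinuous
    convert this using 2 with u
    rw [integral_add (hw.integrable_comp_Lp hp u) (hf.integrable_comp_Lp hp u), neg_one_mul]
    abel
  · have key : ∀ v : LpRd p d, (∫ ω, (K * (1 + ‖v ω‖ ^ p) + -1 * f (v ω))) +
        -1 * ∫ ω, K * (1 + ‖v ω‖ ^ p) = - ∫ ω, f (v ω) := by
      intro v
      rw [integral_add (hw.integrable_comp_Lp hp v) ((hf.const_mul (-1)).integrable_comp_Lp hp v),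
        integral_const_mul (-1), neg_one_mul, neg_one_mul]
      abel
    have := hsub.add (hWc (-1)).lowerSemicontinuous
    simp only [key] at this
    filter_upwards [this u (-a) (neg_lt_neg ha)] with v hv
    exact neg_lt_neg_iff.1 hv

end Law

/-- Infima of lower semicontinuous functions over `P_p` are universally measurable. -/
theorem aemeasurable_iInf_Pp {X : Type*} [TopologicalSpace X] [PolishSpace X] [MeasurableSpace X]
    [BorelSpace X] {d : ℕ} {p : ℝ} (hp : 1 ≤ p) (μ : Measure X) [IsFiniteMeasure μ]
    {g : X × Pp p d → ℝ≥0∞} (hg : LowerSemicontinuous g) :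
    AEMeasurable (fun x => ⨅ ρ : Pp p d, g (x, ρ)) μ := by
  have : Fact (1 ≤ ENNReal.ofReal p) := ⟨by simpa using hp⟩
  have : Fact (ENNReal.ofReal p ≠ ∞) := ⟨ENNReal.ofReal_ne_top⟩
  have hG : LowerSemicontinuous fun q : X × LpRd p d => g (q.1, lawPp hp q.2) :=
    hg.comp (continuous_fst.prodMk ((continuous_lawPp hp).comp continuous_snd))
  have hset : ∀ r : ℝ≥0∞, NullMeasurableSet {x | ⨅ ρ : Pp p d, g (x, ρ) < r} μ := by
    intro r
    have hclosed : ∀ s : ℝ≥0∞,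
        AnalyticSet (Prod.fst '' {q : X × LpRd p d | g (q.1, lawPp hp q.2) ≤ s}) := fun s =>
      (hG.isClosed_preimage s).analyticSet.image_of_continuous continuous_fst
    obtain ⟨u, -, hu, hulim⟩ : ∃ u : ℕ → ℝ≥0∞, Monotone u ∧ (∀ n, r = 0 ∨ u n < r) ∧
        Tendsto u atTop (𝓝 r) := by
      rcases eq_or_ne r 0 with rfl | hr
      · exact ⟨fun _ => 0, monotone_const, by simp, tendsto_const_nhds⟩
      · obtain ⟨u, hmono, hlt, hlim⟩ := exists_seq_strictMono_tendsto' (pos_iff_ne_zero.2 hr)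
        exact ⟨u, hmono.monotone, fun n => Or.inr (hlt n).2, hlim⟩
    have heq : {x | ⨅ ρ : Pp p d, g (x, ρ) < r} = ⋃ n, if r = 0 then ∅ else
        Prod.fst '' {q : X × LpRd p d | g (q.1, lawPp hp q.2) ≤ u n} := by
      ext x
      rcases eq_or_ne r 0 with hr | hr
      · simp [hr]
      simp only [mem_ofPred_eq, hr, if_false, mem_iUnion, mem_image, Prod.exists, exists_and_right,
        exists_eq_right, iInf_lt_iff]
      constructor
      · rintro ⟨ρ, hρ⟩
        obtain ⟨v, rfl⟩ := surjective_lawPp hp ρ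
        obtain ⟨n, hn⟩ := (hulim.eventually (lt_mem_nhds hρ)).exists
        exact ⟨n, v, hn.le⟩
      · rintro ⟨n, v, hv⟩
        exact ⟨_, hv.trans_lt ((hu n).resolve_left hr)⟩
    rw [heq]
    refine NullMeasurableSet.iUnion fun n => ?_
    split_ifs
    · exact MeasurableSet.empty.nullMeasurableSet
    · exact (hclosed _).nullMeasurableSet μ
  refine NullMeasurable.aemeasurable fun s hs => ?_
  have : Measurable[_, _] (fun x : NullMeasurableSpace X μ => ⨅ ρ : Pp p d, g (x, ρ)) :=
    measurable_of_Iio fun r => hset r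
  exact this hs

section ExtendedIntegral

variable {α : Type*} [MeasurableSpace α] {μ : Measure α}

@[simp]
theorem erealToENN_coe (r : ℝ) : erealToENN (r : EReal) = ENNReal.ofReal r := by
  simp [erealToENN]

theorem eInt_eq_integral {f : α → ℝ} (hf : Integrable f μ) :
    eInt μ (fun x => (f x : EReal)) = ((∫ x, f x ∂μ : ℝ) : EReal) := by
  have h1 : ∫⁻ x, ENNReal.ofReal (f x) ∂μ ≠ ∞ := hf.lintegral_lt_top.ne
  have h2 : ∫⁻ x, ENNReal.ofReal (-f x) ∂μ ≠ ∞ := hf.neg.lintegral_lt_top.ne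
  simp only [eInt, ← EReal.coe_neg, erealToENN_coe]
  rw [integral_eq_lintegral_pos_part_sub_lintegral_neg_part hf, EReal.coe_sub,
    EReal.coe_ennreal_toReal h1, EReal.coe_ennreal_toReal h2]

theorem eInt_eq_top {f : α → ℝ} (hf : AEStronglyMeasurable f μ) (hfi : ¬Integrable f μ)
    (h : ∫⁻ x, ENNReal.ofReal (-f x) ∂μ ≠ ∞) : eInt μ (fun x => (f x : EReal)) = ⊤ := by
  simp only [eInt, ← EReal.coe_neg, erealToENN_coe]
  have h1 : ∫⁻ x, ENNReal.ofReal (f x) ∂μ = ∞ := by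
    by_contra hcon
    refine hfi ⟨hf, ?_⟩
    have habs : ∀ x, ‖f x‖ₑ ≤ ENNReal.ofReal (f x) + ENNReal.ofReal (-f x) := fun x => by
      rw [Real.enorm_eq_ofReal_abs]
      rcases abs_cases (f x) with h | h <;> rw [h.1]
      · exact le_self_add
      · exact le_add_self
    rw [HasFiniteIntegral]
    refine (lintegral_mono habs).trans_lt ?_
    rw [lintegral_add_left' hf.aemeasurable.ennreal_ofReal]
    exact (ENNReal.add_ne_top.2 ⟨hcon, h⟩).lt_top
  rw [h1]
  lift (∫⁻ x, ENNReal.ofReal (-f x) ∂μ) to NNReal using h with r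
  rfl

end ExtendedIntegral

section Spreading

variable {p : ℝ} {d : ℕ}

theorem ConvexOn.continuous_rd {f : Rd d → ℝ} (hf : ConvexOn ℝ univ f) : Continuous f :=
  continuousOn_univ.1 (hf.continuousOn isOpen_univ)

theorem ConvexOn.exists_neg_le_weight (hp : 1 ≤ p) {f : Rd d → ℝ} (hf : ConvexOn ℝ univ f) :
    ∃ K : ℝ, ∀ y, -f y ≤ K * (1 + ‖y‖ ^ p) := by
  obtain ⟨l, c, hl, -⟩ := hf.exists_affine_le_of_lt (𝕜 := ℝ) (mem_univ 0) (sub_one_lt (f 0))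
    isClosed_univ (hf.continuous_rd.lowerSemicontinuous.lowerSemicontinuousOn _)
  refine ⟨‖l‖ + |c|, fun y => ?_⟩
  have h1 : l y + c ≤ f y := by simpa using hl ⟨y, mem_univ y⟩
  have h2 : -l y ≤ ‖l‖ * ‖y‖ := (neg_le_abs _).trans (l.le_opNorm y)
  have h3 : ‖y‖ ≤ 1 + ‖y‖ ^ p := by
    rcases le_total ‖y‖ 1 with h | h
    · linarith [one_le_weight p y]
    · linarith [Real.self_le_rpow_of_one_le h hp]
  have h4 : ‖l‖ * ‖y‖ ≤ ‖l‖ * (1 + ‖y‖ ^ p) := mul_le_mul_of_nonneg_left h3 (norm_nonneg _)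
  have h5 : |c| ≤ |c| * (1 + ‖y‖ ^ p) :=
    le_mul_of_one_le_right (abs_nonneg c) (one_le_weight p y)
  linarith [neg_abs_le c]

theorem ConvexOn.lintegral_neg_ne_top (hp : 1 ≤ p) {f : Rd d → ℝ} (hf : ConvexOn ℝ univ f)
    (ρ : Pp p d) : ∫⁻ y, ENNReal.ofReal (-f y) ∂ρ.1 ≠ ∞ := by
  obtain ⟨K, hK⟩ := hf.exists_neg_le_weight hp
  refine ne_top_of_le_ne_top ?_ (lintegral_mono fun y => ENNReal.ofReal_le_ofReal (hK y))
  exact ((ρ.2.2.integrable_weight (by linarith)).const_mul K).lintegral_lt_top.ne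

theorem hasMomentP_of_integrable_weight {ρ : Measure (Rd d)}
    (h : Integrable (fun y : Rd d => 1 + ‖y‖ ^ p) ρ) : HasMomentP p ρ := by
  refine ne_top_of_le_ne_top h.lintegral_lt_top.ne
    (lintegral_mono fun y => ENNReal.ofReal_le_ofReal ?_)
  linarith

theorem GrowthP.comp_add (hp : 0 ≤ p) {f : Rd d → ℝ} (hf : GrowthP p f) {M : ℝ} :
    ∃ K : ℝ, ∀ y z : Rd d, ‖z‖ ≤ M → |f (y + z)| ≤ K * (1 + ‖y‖ ^ p) := by
  obtain ⟨-, K, hK0, hK⟩ := (growthP_iff f).1 hf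
  refine ⟨K * (2 ^ p * (1 + M ^ p) + 1), fun y z hz => (hK _).trans ?_⟩
  rw [mul_assoc]
  refine mul_le_mul_of_nonneg_left ((weight_add_le hp y z).trans ?_) hK0
  have h1 := one_le_weight p y
  have h2 : ‖z‖ ^ p ≤ M ^ p := Real.rpow_le_rpow (norm_nonneg _) hz hp
  gcongr

theorem GrowthP.integrable_add (hp : 0 ≤ p) {f : Rd d → ℝ} (hf : GrowthP p f) (ρ : Pp p d)
    {z : Rd d → Rd d} (hz : Measurable z) {M : ℝ} (hM : ∀ y, ‖z y‖ ≤ M) :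
    Integrable (fun y => f (y + z y)) ρ.1 := by
  obtain ⟨K, hK⟩ := hf.comp_add hp (M := M)
  exact ((ρ.2.2.integrable_weight hp).const_mul K).mono'
    (hf.1.measurable.comp (measurable_id.add hz)).aestronglyMeasurable
    (Eventually.of_forall fun y => hK y _ (hM y))

/-- The law of `y + z y` for `y` distributed according to `ρ`. -/
theorem Pp.map_add_mem (hp : 0 ≤ p) (ρ : Pp p d)
    {z : Rd d → Rd d} (hz : Measurable z) {M : ℝ} (hM : ∀ y, ‖z y‖ ≤ M) :
    IsProbabilityMeasure (ρ.1.map fun y => y + z y) ∧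
      HasMomentP p (ρ.1.map fun y => y + z y) := by
  have hm : Measurable fun y => y + z y := measurable_id.add hz
  refine ⟨Measure.isProbabilityMeasure_map hm.aemeasurable, hasMomentP_of_integrable_weight ?_⟩
  rw [integrable_map_measure (continuous_weight hp).aestronglyMeasurable hm.aemeasurable]
  exact (growthP_weight hp).integrable_add hp ρ hz hM

/-- Splitting the mass at each `y` evenly between `y + z y` and `y - z y` increases a measure in
the convex order. -/
theorem exists_convexOrder_spread (hp : 1 ≤ p) (ρ : Pp p d)
    {z : Rd d → Rd d} (hz : Measurable z) {M : ℝ} (hM : ∀ y, ‖z y‖ ≤ M) :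
    ∃ ρ' : Pp p d, ConvexOrder ρ.1 ρ'.1 ∧ ∀ f : Rd d → ℝ, GrowthP p f →
      ∫ y, f y ∂ρ'.1 = ∫ y, (f (y + z y) + f (y - z y)) / 2 ∂ρ.1 := by
  have hp0 : 0 ≤ p := by linarith
  have hM' : ∀ y, ‖(fun y => -z y) y‖ ≤ M := fun y => by simpa using hM y
  have hm₁ : Measurable fun y => y + z y := measurable_id.add hz
  have hm₂ : Measurable fun y => y + -z y := measurable_id.add hz.neg
  let ρ₁ : Pp p d := ⟨_, Pp.map_add_mem hp0 ρ hz hM⟩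
  let ρ₂ : Pp p d := ⟨ρ.1.map fun y => y + -z y, Pp.map_add_mem hp0 ρ hz.neg hM'⟩
  have h2 : (0 : ℝ) ≤ 1 / 2 := by norm_num
  have h2' : (1 / 2 : ℝ) ≤ 1 := by norm_num
  have key : ∀ f : Rd d → ℝ, Continuous f → Integrable f ρ₁.1 → Integrable f ρ₂.1 →
      ∫ y, f y ∂(ENNReal.ofReal (1 / 2) • ρ₁.1 + ENNReal.ofReal (1 - 1 / 2) • ρ₂.1) =
        ∫ y, (f (y + z y) + f (y - z y)) / 2 ∂ρ.1 := by
    intro f hf hf₁ hf₂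
    rw [Pp.integral_mix h2 h2' hf₁ hf₂,
      integral_map hm₁.aemeasurable hf.aestronglyMeasurable,
      integral_map hm₂.aemeasurable hf.aestronglyMeasurable, integral_div, integral_add]
    · simp only [sub_eq_add_neg]
      ring
    · exact hf₁.comp_measurable hm₁
    · simpa only [sub_eq_add_neg, Function.comp_def] using hf₂.comp_measurable hm₂
  refine ⟨⟨_, Pp.mix_mem ρ₁ ρ₂ h2 h2'⟩, fun f hf => ?_,
    fun f hf => key f hf.1 (hf.integrable_pp hp0 ρ₁) (hf.integrable_pp hp0 ρ₂)⟩
  have hfc := hf.continuous_rd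
  let ρ' : Pp p d := ⟨_, Pp.mix_mem ρ₁ ρ₂ h2 h2'⟩
  by_cases hi : Integrable f ρ'.1
  swap
  · rw [eInt_eq_top hfc.aestronglyMeasurable hi (hf.lintegral_neg_ne_top hp ρ')]
    exact le_top
  have hi₁ : Integrable f ρ₁.1 := by
    have := (integrable_add_measure.1 hi).1
    rwa [integrable_smul_measure (by simp) (by simp)] at this
  have hi₂ : Integrable f ρ₂.1 := by
    have := (integrable_add_measure.1 hi).2
    rwa [integrable_smul_measure (by norm_num) (by simp)] at this
  have hj₁ : Integrable (fun y => f (y + z y)) ρ.1 := hi₁.comp_measurable hm₁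
  have hj₂ : Integrable (fun y => f (y - z y)) ρ.1 := by
    simpa only [sub_eq_add_neg, Function.comp_def] using hi₂.comp_measurable hm₂
  have hle : ∀ y, f y ≤ (f (y + z y) + f (y - z y)) / 2 := fun y => by
    have := hf.2 (mem_univ (y + z y)) (mem_univ (y - z y)) h2 h2 (by norm_num)
    have h3 : (1 / 2 : ℝ) • (y + z y) + (1 / 2 : ℝ) • (y - z y) = y := by
      rw [← smul_add, add_add_sub_cancel, ← two_smul ℝ y, smul_smul]
      norm_num
    rw [h3, smul_eq_mul, smul_eq_mul] at this
    linarith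
  have hj : Integrable (fun y => (f (y + z y) + f (y - z y)) / 2) ρ.1 := (hj₁.add hj₂).div_const 2
  have hiρ : Integrable f ρ.1 := by
    obtain ⟨K, hK⟩ := hf.exists_neg_le_weight hp
    refine (hj.abs.add ((ρ.2.2.integrable_weight hp0).const_mul |K|)).mono'
      hfc.aestronglyMeasurable (Eventually.of_forall fun y => ?_)
    have h4 := le_abs_self ((f (y + z y) + f (y - z y)) / 2)
    have h5 : K * (1 + ‖y‖ ^ p) ≤ |K| * (1 + ‖y‖ ^ p) :=
      mul_le_mul_of_nonneg_right (le_abs_self K) (by linarith [one_le_weight p y])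
    have h6 : 0 ≤ |K| * (1 + ‖y‖ ^ p) :=
      mul_nonneg (abs_nonneg K) (by linarith [one_le_weight p y])
    have h7 := abs_nonneg ((f (y + z y) + f (y - z y)) / 2)
    rw [Real.norm_eq_abs, abs_le, Pi.add_apply]
    constructor <;> linarith [hle y, hK y]
  rw [eInt_eq_integral hiρ, eInt_eq_integral hi, key f hfc hi₁ hi₂, EReal.coe_le_coe_iff]
  exact integral_mono hiρ hj hle

end Spreading

section Convexity

theorem convexOn_univ_of_midpoint {E : Type*} [AddCommGroup E] [Module ℝ E] [TopologicalSpace E]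
    [IsTopologicalAddGroup E] [ContinuousSMul ℝ E] {f : E → ℝ} (hf : UpperSemicontinuous f)
    (hm : ∀ x h, f x ≤ (f (x + h) + f (x - h)) / 2) : ConvexOn ℝ univ f := by
  refine ⟨convex_univ, fun x _ y _ a b ha hb hab => ?_⟩
  let φ : ℝ → ℝ := fun t => f (x + t • (y - x)) + -((1 - t) * f x + t * f y)
  have hφ : UpperSemicontinuous φ := by
    refine UpperSemicontinuous.add ?_ (Continuous.upperSemicontinuous (by fun_prop))
    exact hf.comp (by fun_prop : Continuous fun t : ℝ => x + t • (y - x))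
  obtain ⟨t, ⟨ht0, ht1⟩, ht⟩ := (hφ.upperSemicontinuousOn (Icc 0 1)).exists_isMaxOn
    (nonempty_Icc.2 zero_le_one) isCompact_Icc
  have hmid : ∀ t h, φ t ≤ (φ (t + h) + φ (t - h)) / 2 := fun t h => by
    have := hm (x + t • (y - x)) (h • (y - x))
    rw [add_assoc, ← add_smul, add_sub_assoc, ← sub_smul] at this
    simp only [φ]
    linarith
  have h0 : φ 0 = 0 := by simp [φ]
  have h1 : φ 1 = 0 := by simp [φ]
  have hle : φ t ≤ 0 := by
    rcases le_total t (1 / 2) with h | h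
    · have h2 := hmid t t
      rw [sub_self, h0] at h2
      have h3 : φ (t + t) ≤ φ t := ht ⟨by linarith, by linarith⟩
      linarith
    · have h2 := hmid t (1 - t)
      rw [add_sub_cancel, h1] at h2
      have h3 : φ (t - (1 - t)) ≤ φ t := ht ⟨by linarith, by linarith⟩
      linarith
  obtain rfl : a = 1 - b := eq_sub_of_add_eq hab
  have hb' : φ b ≤ 0 := (ht (⟨hb, by linarith⟩ : b ∈ Icc (0 : ℝ) 1) : φ b ≤ φ t).trans hle
  have hxy : x + b • (y - x) = (1 - b) • x + b • y := by
    rw [smul_sub, sub_smul, one_smul]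
    abel
  simp only [φ, hxy] at hb'
  rw [smul_eq_mul, smul_eq_mul]
  linarith

end Convexity

section ConvexReduction

variable {p : ℝ} {d : ℕ}

theorem GrowthP.of_le_of_le {f g h : Rd d → ℝ} (hg : GrowthP p g) (hh : GrowthP p h)
    (hf : Continuous f) (h1 : ∀ y, g y ≤ f y) (h2 : ∀ y, f y ≤ h y) : GrowthP p f := by
  obtain ⟨-, K, hK⟩ := hg
  obtain ⟨-, M, hM⟩ := hh
  refine ⟨hf, K + M, fun y => ?_⟩
  rw [add_mul, abs_le]
  have h3 := abs_le.1 (hK y)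
  have h4 := abs_le.1 (hM y)
  constructor <;> linarith [h1 y, h2 y]

/-- Iterated midpoint minimization along a sequence of directions. -/
noncomputable def midMin (q : ℕ → Rd d) (ψ : Rd d → ℝ) : ℕ → Rd d → ℝ
  | 0 => ψ
  | n + 1 => fun y =>
      min (midMin q ψ n y) ((midMin q ψ n (y + q n) + midMin q ψ n (y - q n)) / 2)

theorem continuous_midMin (q : ℕ → Rd d) {ψ : Rd d → ℝ} (hψ : Continuous ψ) (n : ℕ) :
    Continuous (midMin q ψ n) := by
  induction n with
  | zero => exact hψ
  | succ n ih => rw [midMin]; fun_prop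

theorem antitone_midMin (q : ℕ → Rd d) (ψ : Rd d → ℝ) (y : Rd d) :
    Antitone fun n => midMin q ψ n y :=
  antitone_nat_of_succ_le fun _ => min_le_left _ _

theorem le_midMin (q : ℕ → Rd d) {ψ b : Rd d → ℝ} (hb : ConvexOn ℝ univ b)
    (h : ∀ y, b y ≤ ψ y) (n : ℕ) (y : Rd d) : b y ≤ midMin q ψ n y := by
  induction n generalizing y with
  | zero => exact h y
  | succ n ih =>
    refine le_min (ih y) ?_
    have h2 : (0 : ℝ) ≤ 1 / 2 := by norm_num
    have := hb.2 (mem_univ (y + q n)) (mem_univ (y - q n)) h2 h2 (by norm_num)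
    have h3 : (1 / 2 : ℝ) • (y + q n) + (1 / 2 : ℝ) • (y - q n) = y := by
      rw [← smul_add, add_add_sub_cancel, ← two_smul ℝ y, smul_smul]
      norm_num
    rw [h3, smul_eq_mul, smul_eq_mul] at this
    linarith [ih (y + q n), ih (y - q n)]

theorem le_integral_min_midpoint_add (hp : 1 ≤ p) {f : Rd d → ℝ} (hf : GrowthP p f) (q : Rd d)
    {C : Pp p d → EReal} (hC : ∀ ρ₁ ρ₂ : Pp p d, ConvexOrder ρ₁.1 ρ₂.1 → C ρ₂ ≤ C ρ₁) {r : EReal}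
    (hr : ∀ ρ : Pp p d, r ≤ ((∫ y, f y ∂ρ.1 : ℝ) : EReal) + C ρ) (ρ : Pp p d) :
    r ≤ ((∫ y, min (f y) ((f (y + q) + f (y - q)) / 2) ∂ρ.1 : ℝ) : EReal) + C ρ := by
  classical
  have hfc := hf.1
  let z : Rd d → Rd d := fun y => if (f (y + q) + f (y - q)) / 2 < f y then q else 0
  have hz : Measurable z :=
    Measurable.ite (measurableSet_lt (by fun_prop) (by fun_prop)) measurable_const measurable_const
  obtain ⟨ρ', h1, h2⟩ := exists_convexOrder_spread hp ρ hz (M := ‖q‖) fun y => by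
    simp only [z]
    split_ifs <;> simp
  refine (hr ρ').trans (add_le_add (le_of_eq ?_) (hC _ _ h1))
  rw [h2 f hf]
  congr 2
  ext y
  simp only [z]
  split_ifs with h
  · rw [min_eq_right h.le]
  · rw [min_eq_left (not_lt.1 h)]
    simp

theorem convexOn_iInf_midMin {q : ℕ → Rd d} (hq : ∀ u : Rd d, ∀ k : ℕ, ∀ O ∈ 𝓝 u, ∃ n ≥ k, q n ∈ O)
    {ψ : Rd d → ℝ} (hψ : Continuous ψ) (hb : ∀ y, BddBelow (range fun n => midMin q ψ n y)) :
    ConvexOn ℝ univ fun y => ⨅ n, midMin q ψ n y := by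
  have husc : UpperSemicontinuous fun y => ⨅ n, midMin q ψ n y :=
    upperSemicontinuous_ciInf hb fun n => (continuous_midMin q hψ n).upperSemicontinuous
  refine convexOn_univ_of_midpoint husc fun x h => le_of_forall_pos_lt_add fun ε hε => ?_
  have h1 : ∃ k, midMin q ψ k (x + h) < (⨅ n, midMin q ψ n (x + h)) + ε :=
    exists_lt_of_ciInf_lt (by linarith)
  have h2 : ∃ k, midMin q ψ k (x - h) < (⨅ n, midMin q ψ n (x - h)) + ε :=
    exists_lt_of_ciInf_lt (by linarith)
  obtain ⟨k₁, hk₁⟩ := h1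
  obtain ⟨k₂, hk₂⟩ := h2
  have e1 : ∀ᶠ u in 𝓝 h, midMin q ψ k₁ (x + u) < (⨅ n, midMin q ψ n (x + h)) + ε :=
    ((continuous_midMin q hψ k₁).comp (continuous_const.add continuous_id)).continuousAt.eventually_lt
      continuousAt_const hk₁
  have e2 : ∀ᶠ u in 𝓝 h, midMin q ψ k₂ (x - u) < (⨅ n, midMin q ψ n (x - h)) + ε :=
    ((continuous_midMin q hψ k₂).comp (continuous_const.sub continuous_id)).continuousAt.eventually_lt
      continuousAt_const hk₂
  obtain ⟨n, hn, hn1, hn2⟩ := hq h (max k₁ k₂) _ (e1.and e2)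
  have h3 : (⨅ n, midMin q ψ n x) ≤ midMin q ψ (n + 1) x := ciInf_le (hb x) _
  have h4 : midMin q ψ (n + 1) x ≤ (midMin q ψ n (x + q n) + midMin q ψ n (x - q n)) / 2 :=
    min_le_right _ _
  have h5 := antitone_midMin q ψ (x + q n) ((le_max_left _ _).trans hn)
  have h6 := antitone_midMin q ψ (x - q n) ((le_max_right _ _).trans hn)
  simp only at h5 h6
  linarith

theorem exists_forall_nhds_ge (d : ℕ) :
    ∃ q : ℕ → Rd d, ∀ u : Rd d, ∀ k : ℕ, ∀ O ∈ 𝓝 u, ∃ n ≥ k, q n ∈ O := by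
  refine ⟨fun n => TopologicalSpace.denseSeq (Rd d) n.unpair.1, fun u k O hO => ?_⟩
  obtain ⟨_, hy, m, rfl⟩ := mem_closure_iff_nhds.1 (TopologicalSpace.denseRange_denseSeq (Rd d) u) O hO
  exact ⟨Nat.pair m k, Nat.right_le_pair m k, by simpa using hy⟩

/-- Any potential bounded below by a convex function may be replaced by a smaller convex potential
without affecting lower bounds on the penalized problem with a `≼_c`-decreasing penalty. -/
theorem exists_convex_potential (hp : 1 ≤ p) {ψ b : Rd d → ℝ} (hψ : GrowthP p ψ)
    (hb : GrowthP p b) (hbc : ConvexOn ℝ univ b) (hle : ∀ y, b y ≤ ψ y) :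
    ∃ g : Rd d → ℝ, ConvexOn ℝ univ g ∧ GrowthP p g ∧ (∀ y, b y ≤ g y) ∧ (∀ y, g y ≤ ψ y) ∧
      ∀ C : Pp p d → EReal, (∀ ρ₁ ρ₂ : Pp p d, ConvexOrder ρ₁.1 ρ₂.1 → C ρ₂ ≤ C ρ₁) →
        ∀ r : EReal, (∀ ρ : Pp p d, r ≤ ((∫ y, ψ y ∂ρ.1 : ℝ) : EReal) + C ρ) →
          ∀ ρ : Pp p d, r ≤ ((∫ y, g y ∂ρ.1 : ℝ) : EReal) + C ρ := by
  have hp0 : 0 ≤ p := by linarith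
  obtain ⟨q, hq⟩ := exists_forall_nhds_ge d
  have hbd : ∀ y, BddBelow (range fun n => midMin q ψ n y) := fun y =>
    ⟨b y, forall_mem_range.2 fun n => le_midMin q hbc hle n y⟩
  have hbg : ∀ y, b y ≤ ⨅ n, midMin q ψ n y := fun y =>
    le_ciInf fun n => le_midMin q hbc hle n y
  have hle' : ∀ n y, midMin q ψ n y ≤ ψ y := fun n y => antitone_midMin q ψ y n.zero_le
  have hgψ : ∀ y, ⨅ n, midMin q ψ n y ≤ ψ y := fun y => ciInf_le (hbd y) 0
  have hconv := convexOn_iInf_midMin hq hψ.1 hbd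
  have hgr : ∀ n, GrowthP p (midMin q ψ n) := fun n =>
    hb.of_le_of_le hψ (continuous_midMin q hψ.1 n) (le_midMin q hbc hle n) (hle' n)
  refine ⟨_, hconv, hb.of_le_of_le hψ hconv.continuous_rd hbg hgψ, hbg, hgψ,
    fun C hC r hr ρ => ?_⟩
  have hn : ∀ n, ∀ ρ : Pp p d, r ≤ ((∫ y, midMin q ψ n y ∂ρ.1 : ℝ) : EReal) + C ρ := by
    intro n
    induction n with
    | zero => exact hr
    | succ n ih => exact le_integral_min_midpoint_add hp (hgr n) (q n) hC ih
  have hlim : Tendsto (fun n => ∫ y, midMin q ψ n y ∂ρ.1) atTop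
      (𝓝 (∫ y, ⨅ n, midMin q ψ n y ∂ρ.1)) := by
    refine tendsto_integral_of_dominated_convergence (fun y => |b y| + |ψ y|)
      (fun n => (hgr n).1.aestronglyMeasurable)
      ((hb.integrable_pp hp0 ρ).abs.add (hψ.integrable_pp hp0 ρ).abs)
      (fun n => Eventually.of_forall fun y => ?_)
      (Eventually.of_forall fun y => tendsto_atTop_ciInf (antitone_midMin q ψ y) (hbd y))
    rw [Real.norm_eq_abs, abs_le]
    have h1 := le_midMin q hbc hle n y
    have h2 := hle' n y
    constructor <;>
      linarith [neg_abs_le (b y), le_abs_self (ψ y), abs_nonneg (b y), abs_nonneg (ψ y)]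
  have hc : Tendsto (fun n => (((∫ y, midMin q ψ n y ∂ρ.1 : ℝ) : EReal), C ρ)) atTop
      (𝓝 (((∫ y, ⨅ n, midMin q ψ n y ∂ρ.1 : ℝ) : EReal), C ρ)) :=
    ((continuous_coe_real_ereal.tendsto _).comp hlim).prodMk_nhds tendsto_const_nhds
  have hc' := (EReal.continuousAt_add
    (p := (((∫ y, ⨅ n, midMin q ψ n y ∂ρ.1 : ℝ) : EReal), C ρ)) (Or.inl (EReal.coe_ne_top _))
    (Or.inl (EReal.coe_ne_bot _))).tendsto.comp hc
  exact ge_of_tendsto' hc' fun n => hn n ρ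

end ConvexReduction

section UpperFamily

variable {p : ℝ} {d : ℕ}

/-- A continuous cutoff equal to `1` on the ball of radius `R` and to `0` off the ball of radius
`R + 1`. -/
noncomputable def radialCutoff (d : ℕ) (R : ℝ) (y : Rd d) : ℝ := max 0 (min 1 (R + 1 - ‖y‖))

theorem continuous_radialCutoff (R : ℝ) : Continuous (radialCutoff d R) := by
  unfold radialCutoff; fun_prop

theorem radialCutoff_nonneg (R : ℝ) (y : Rd d) : 0 ≤ radialCutoff d R y := le_max_left _ _

theorem radialCutoff_le_one (R : ℝ) (y : Rd d) : radialCutoff d R y ≤ 1 :=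
  max_le zero_le_one (min_le_left _ _)

theorem radialCutoff_eq_one {R : ℝ} {y : Rd d} (h : ‖y‖ ≤ R) : radialCutoff d R y = 1 := by
  rw [radialCutoff, min_eq_left (by linarith), max_eq_right zero_le_one]

theorem radialCutoff_eq_zero {R : ℝ} {y : Rd d} (h : R + 1 ≤ ‖y‖) : radialCutoff d R y = 0 := by
  rw [radialCutoff, max_eq_left]
  exact (min_le_right _ _).trans (by linarith)

theorem hasCompactSupport_radialCutoff (R : ℝ) : HasCompactSupport (radialCutoff d R) :=
  HasCompactSupport.intro (isCompact_closedBall (0 : Rd d) (R + 1)) fun y hy =>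
    radialCutoff_eq_zero (by simpa using (not_le.1 (by simpa using hy)).le)

theorem tendsto_radialCutoff (y : Rd d) :
    Tendsto (fun R : ℕ => radialCutoff d R y) atTop (𝓝 1) := by
  obtain ⟨N, hN⟩ := exists_nat_ge ‖y‖
  refine tendsto_const_nhds.congr' ((eventually_ge_atTop N).mono fun R hR => ?_)
  exact (radialCutoff_eq_one (hN.trans (by exact_mod_cast hR))).symm

theorem tendsto_integral_one_sub_radialCutoff_mul {ρ : Measure (Rd d)} {w : Rd d → ℝ}
    (hw : Integrable w ρ) :
    Tendsto (fun R : ℕ => ∫ y, (1 - radialCutoff d R y) * w y ∂ρ) atTop (𝓝 0) := by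
  have h : Tendsto (fun R : ℕ => ∫ y, (1 - radialCutoff d R y) * w y ∂ρ) atTop
      (𝓝 (∫ y, (1 - 1) * w y ∂ρ)) := by
    refine tendsto_integral_of_dominated_convergence (fun y => |w y|) (fun R => ?_) hw.abs
      (fun R => Eventually.of_forall fun y => ?_) (Eventually.of_forall fun y => ?_)
    · exact (continuous_const.sub (continuous_radialCutoff _)).aestronglyMeasurable.mul
        hw.aestronglyMeasurable
    · rw [Real.norm_eq_abs, abs_mul]
      refine mul_le_of_le_one_left (abs_nonneg _) ?_
      rw [abs_le]
      constructor <;> linarith [radialCutoff_nonneg R y, radialCutoff_le_one R y]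
    · exact ((tendsto_radialCutoff y).const_sub 1).mul_const _
  simpa using h

/-- A countable family in `C_{b,p}` approximating from above, in `L¹(ρ)` for each `ρ ∈ P_p`,
all continuous functions of growth of order `p`. -/
theorem exists_countable_upper_family (hp : 0 ≤ p) :
    ∃ u : ℕ → Rd d → ℝ, (∀ k, Cbp p (u k)) ∧ ∀ ψ : Rd d → ℝ, GrowthP p ψ → ∀ ρ : Pp p d,
      ∀ ε : ℝ, 0 < ε → ∃ k, (∀ y, ψ y ≤ u k y) ∧ ∫ y, u k y ∂ρ.1 < ∫ y, ψ y ∂ρ.1 + ε := by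
  let g : ℕ → C(Rd d, ℝ) := TopologicalSpace.denseSeq _
  let U : ℕ × ℕ × ℕ × ℕ → Rd d → ℝ := fun i y =>
    g i.1 y * radialCutoff d i.2.1 y +
      (i.2.2.1 * ((1 - radialCutoff d i.2.1 y) * (1 + ‖y‖ ^ p)) + 1 / ((i.2.2.2 : ℝ) + 1))
  have hU : ∀ i, Cbp p (U i) := by
    rintro ⟨k, R, K, m⟩
    have h1 : Continuous fun y => g k y * radialCutoff d R y :=
      (g k).continuous.mul (continuous_radialCutoff _)
    obtain ⟨B, hB⟩ := h1.bounded_above_of_compact_support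
      ((hasCompactSupport_radialCutoff (d := d) R).mul_left (f := g k))
    have h2 : Cbp p fun y => g k y * radialCutoff d R y :=
      GrowthP.cbp (c := -B) ⟨h1, B, fun y => (hB y).trans
        (le_mul_of_one_le_right ((norm_nonneg _).trans (hB y)) (one_le_weight p y))⟩
        fun y => (abs_le.1 (hB y)).1
    have h3 : Cbp p fun y : Rd d => (1 - radialCutoff d R y) * (1 + ‖y‖ ^ p) := by
      have h0 : ∀ y : Rd d, 0 ≤ (1 - radialCutoff d R y) * (1 + ‖y‖ ^ p) := fun y =>
        mul_nonneg (by linarith [radialCutoff_le_one R y]) (by linarith [one_le_weight p y])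
      refine GrowthP.cbp (c := 0)
        ⟨(continuous_const.sub (continuous_radialCutoff _)).mul (continuous_weight hp), 1,
          fun y => ?_⟩ h0
      rw [abs_of_nonneg (h0 y)]
      exact mul_le_mul_of_nonneg_right (by linarith [radialCutoff_nonneg R y])
        (by linarith [one_le_weight p y])
    exact h2.add hp ((h3.const_mul hp K.cast_nonneg).add hp (cbp_const _))
  obtain ⟨e, he⟩ := exists_surjective_nat (ℕ × ℕ × ℕ × ℕ)
  refine ⟨fun n => U (e n), fun n => hU _, fun ψ hψ ρ ε hε => ?_⟩
  suffices ∃ i, (∀ y, ψ y ≤ U i y) ∧ ∫ y, U i y ∂ρ.1 < ∫ y, ψ y ∂ρ.1 + ε by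
    obtain ⟨i, hi⟩ := this
    obtain ⟨n, rfl⟩ := he i
    exact ⟨n, hi⟩
  obtain ⟨-, K', hK'0, hK'⟩ := (growthP_iff ψ).1 hψ
  obtain ⟨K, hKK⟩ := exists_nat_ge K'
  have hK : ∀ y, |ψ y| ≤ K * (1 + ‖y‖ ^ p) := fun y =>
    (hK' y).trans (mul_le_mul_of_nonneg_right hKK (by linarith [one_le_weight p y]))
  obtain ⟨m, hm⟩ := exists_nat_one_div_lt (show (0 : ℝ) < ε / 4 by linarith)
  set δ : ℝ := 1 / ((m : ℝ) + 1) with hδ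
  have hδ0 : 0 < δ := by positivity
  have hw := ρ.2.2.integrable_weight hp
  have hlim := (tendsto_integral_one_sub_radialCutoff_mul hw).const_mul (2 * K : ℝ)
  rw [mul_zero] at hlim
  obtain ⟨R, hR⟩ := (hlim.eventually_lt_const (show (0 : ℝ) < ε / 2 by linarith)).exists
  let ψ' : C(Rd d, ℝ) := ⟨ψ, hψ.1⟩
  have hopen : IsOpen {h : C(Rd d, ℝ) | MapsTo (h - ψ') (Metric.closedBall 0 (R + 1))
      (Metric.ball 0 δ)} :=
    (ContinuousMap.isOpen_setOfPred_mapsTo (isCompact_closedBall _ _) Metric.isOpen_ball).preimage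
      (continuous_id.sub continuous_const)
  obtain ⟨k, hk⟩ := (TopologicalSpace.denseRange_denseSeq C(Rd d, ℝ)).exists_mem_open hopen
    ⟨ψ', fun y _ => by simpa using hδ0⟩
  have hk' : ∀ y, |(g k y - ψ y) * radialCutoff d R y| ≤ δ := fun y => by
    rcases le_total (R + 1 : ℝ) ‖y‖ with h | h
    · rw [radialCutoff_eq_zero h]
      simpa using hδ0.le
    · have h1 := hk (show y ∈ Metric.closedBall 0 (R + 1 : ℝ) by simpa using h)
      have h2 : |g k y - ψ y| < δ := by simpa [ψ'] using h1
      rw [abs_mul, abs_of_nonneg (radialCutoff_nonneg R y)]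
      exact (mul_le_of_le_one_right (abs_nonneg _) (radialCutoff_le_one R y)).trans h2.le
  have hdiff : ∀ y, U (k, R, K, m) y = ψ y + ((g k y - ψ y) * radialCutoff d R y +
      ((1 - radialCutoff d R y) * (K * (1 + ‖y‖ ^ p) - ψ y) + δ)) := fun y => by
    simp only [U]
    ring
  have hχ : ∀ y, 0 ≤ 1 - radialCutoff d R y := fun y => by linarith [radialCutoff_le_one R y]
  refine ⟨(k, R, K, m), fun y => ?_, ?_⟩
  · have h1 := mul_nonneg (hχ y) (sub_nonneg.2 (abs_le.1 (hK y)).2)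
    rw [hdiff]
    linarith [(abs_le.1 (hk' y)).1]
  · have h1 : ∀ y, U (k, R, K, m) y ≤ (ψ y + 2 * δ) +
        2 * K * ((1 - radialCutoff d R y) * (1 + ‖y‖ ^ p)) := fun y => by
      have h2 := mul_le_mul_of_nonneg_left
        (show K * (1 + ‖y‖ ^ p) - ψ y ≤ 2 * K * (1 + ‖y‖ ^ p) by linarith [(abs_le.1 (hK y)).1])
        (hχ y)
      rw [hdiff]
      linarith [(abs_le.1 (hk' y)).2]
    have hi1 : Integrable (fun y => (1 - radialCutoff d R y) * (1 + ‖y‖ ^ p)) ρ.1 :=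
      hw.bdd_mul (c := 1) (continuous_const.sub (continuous_radialCutoff _)).aestronglyMeasurable
        (Eventually.of_forall fun y => by
          rw [Real.norm_eq_abs, abs_of_nonneg (hχ y)]
          linarith [radialCutoff_nonneg R y])
    have hiψ := hψ.integrable_pp hp ρ
    have hi2 : Integrable (fun y => ψ y + 2 * δ) ρ.1 := hiψ.add (integrable_const _)
    have h2 := integral_mono (((hU (k, R, K, m)).growthP hp).integrable_pp hp ρ)
      (hi2.add (hi1.const_mul (2 * K))) h1
    simp only [Pi.add_apply] at h2
    rw [integral_add hi2 (hi1.const_mul (2 * K)),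
      integral_add hiψ (integrable_const (2 * δ)), integral_const_mul (2 * K : ℝ)] at h2
    simp only [integral_const, probReal_univ, one_smul] at h2
    linarith

end UpperFamily

section Separation

variable {p : ℝ} {d : ℕ}

theorem Pp.exists_finset_of_mem_nhds {ρ₀ : Pp p d} {O : Set (Pp p d)} (hO : O ∈ 𝓝 ρ₀) :
    ∃ (s : Finset {f : Rd d → ℝ // GrowthP p f}) (V : Set (s → ℝ)),
      V ∈ 𝓝 (fun i : s => ∫ y, i.1.1 y ∂ρ₀.1) ∧
        ∀ ρ : Pp p d, (fun i : s => ∫ y, i.1.1 y ∂ρ.1) ∈ V → ρ ∈ O := by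
  classical
  have h1 : 𝓝 ρ₀ = ⨅ f : {f : Rd d → ℝ // GrowthP p f},
      comap (fun ρ : Pp p d => ∫ y, f.1 y ∂ρ.1) (𝓝 (∫ y, f.1 y ∂ρ₀.1)) := by
    rw [nhds_iInf]
    simp only [nhds_induced]
  rw [h1, Filter.mem_iInf] at hO
  obtain ⟨I, hI, W, hW, rfl⟩ := hO
  choose t ht htW using fun i => mem_comap.1 (hW i)
  have : Fintype I := hI.fintype
  refine ⟨hI.toFinset, univ.pi fun i => t ⟨i.1, hI.mem_toFinset.1 i.2⟩,
    set_pi_mem_nhds finite_univ fun i _ => ht ⟨i.1, hI.mem_toFinset.1 i.2⟩, fun ρ hρ => ?_⟩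
  refine mem_iInter.2 fun i => htW i ?_
  exact hρ ⟨i.1, hI.mem_toFinset.2 i.2⟩ (mem_univ _)

/-- A convex lower semicontinuous nonnegative functional on `P_p` is a supremum of affine
functionals given by integrals of continuous functions of growth of order `p`. -/
theorem exists_growthP_separating (hp : 0 ≤ p) {c : Pp p d → ℝ≥0∞} (hc : LowerSemicontinuous c)
    (hconv : ∀ ρ₁ ρ₂ : Pp p d, ∀ t : ℝ, ∀ h0 : 0 ≤ t, ∀ h1 : t ≤ 1,
      c ⟨_, Pp.mix_mem ρ₁ ρ₂ h0 h1⟩ ≤ ENNReal.ofReal t * c ρ₁ + ENNReal.ofReal (1 - t) * c ρ₂)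
    (ρ₀ : Pp p d) {r : ℝ} (hr0 : 0 ≤ r) (hr : ENNReal.ofReal r < c ρ₀) :
    ∃ ψ : Rd d → ℝ, GrowthP p ψ ∧ ∃ v : ℝ, r + ∫ y, ψ y ∂ρ₀.1 < v ∧
      ∀ ρ : Pp p d, ∀ s : ℝ, 0 ≤ s → c ρ ≤ ENNReal.ofReal s → v ≤ ∫ y, ψ y ∂ρ.1 + s := by
  classical
  obtain ⟨r', hr', hr'c⟩ : ∃ r' : ℝ, r < r' ∧ ENNReal.ofReal r' < c ρ₀ := by
    obtain ⟨q, hq1, hq2⟩ := ENNReal.lt_iff_exists_nnreal_btwn.1 hr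
    refine ⟨q, ?_, by simpa using hq2⟩
    have := (ENNReal.ofReal_lt_iff_lt_toReal hr0 ENNReal.coe_ne_top).1 hq1
    simpa using this
  obtain ⟨s, V, hV, hVO⟩ := Pp.exists_finset_of_mem_nhds (hc ρ₀ _ hr'c)
  let T : Pp p d → s → ℝ := fun ρ i => ∫ y, i.1.1 y ∂ρ.1
  let A : Set ((s → ℝ) × ℝ) := {q | ∃ ρ, T ρ = q.1 ∧ 0 ≤ q.2 ∧ c ρ ≤ ENNReal.ofReal q.2}
  by_cases hA : A.Nonempty
  swap
  · refine ⟨fun _ => 0, growthP_const 0, r + 1, by simp, fun ρ σ h0 h1 => ?_⟩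
    exact absurd ⟨(T ρ, σ), ρ, rfl, h0, h1⟩ hA
  have hAconv : Convex ℝ A := by
    rintro ⟨_, σ₁⟩ ⟨ρ₁, rfl, h0₁, h1₁⟩ ⟨_, σ₂⟩ ⟨ρ₂, rfl, h0₂, h1₂⟩ a b ha hb hab
    obtain rfl : b = 1 - a := by linarith
    simp only at h0₁ h0₂ h1₁ h1₂
    have ha1 : a ≤ 1 := by linarith
    refine ⟨⟨_, Pp.mix_mem ρ₁ ρ₂ ha ha1⟩, ?_, ?_, (hconv ρ₁ ρ₂ a ha ha1).trans ?_⟩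
    · ext i
      exact Pp.integral_mix ha ha1 (i.1.2.integrable_pp hp ρ₁) (i.1.2.integrable_pp hp ρ₂)
    · exact add_nonneg (mul_nonneg ha h0₁) (mul_nonneg hb h0₂)
    · simp only [Prod.snd_add, Prod.smul_snd, smul_eq_mul]
      rw [ENNReal.ofReal_add (mul_nonneg ha h0₁) (mul_nonneg hb h0₂), ENNReal.ofReal_mul ha,
        ENNReal.ofReal_mul hb]
      gcongr
  have hP : (T ρ₀, r) ∉ closure A := by
    intro hcl
    obtain ⟨⟨u, σ⟩, ⟨hu, hσ⟩, ρ, hρ, h0, h1⟩ := mem_closure_iff_nhds.1 hcl _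
      (prod_mem_nhds hV (Iio_mem_nhds hr'))
    simp only at hρ h0 h1
    have h2 : ENNReal.ofReal r' < c ρ := hVO ρ (by subst hρ; exact hu)
    exact absurd (h2.trans_le h1) (not_lt.2 (ENNReal.ofReal_le_ofReal (le_of_lt hσ)))
  obtain ⟨l, u, hl1, hl2⟩ := geometric_hahn_banach_point_closed hAconv.closure isClosed_closure hP
  let α : ℝ := l (0, 1)
  let ψ₀ : Rd d → ℝ := fun y => ∑ i : s, l (Pi.single i 1, 0) * i.1.1 y
  have hψ₀ : GrowthP p ψ₀ := GrowthP.sum _ fun i _ => i.1.2.const_mul _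
  have hl : ∀ (ρ : Pp p d) (σ : ℝ), l (T ρ, σ) = ∫ y, ψ₀ y ∂ρ.1 + σ * α := by
    intro ρ σ
    have h1 : (T ρ, σ) = ∑ i : s, T ρ i • ((Pi.single i 1 : s → ℝ), (0 : ℝ)) + σ • (0, 1) := by
      ext i
      · simp [Prod.fst_sum, Finset.sum_apply, Pi.single_apply]
      · simp [Prod.snd_sum]
    rw [h1, map_add, map_sum, map_smul, integral_finsetSum _ fun i _ =>
      (i.1.2.integrable_pp hp ρ).const_mul _]
    simp only [map_smul, smul_eq_mul, integral_const_mul, α]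
    congr 1
    exact Finset.sum_congr rfl fun i _ => mul_comm _ _
  rw [hl] at hl1
  have hl3 : ∀ ρ : Pp p d, ∀ σ : ℝ, 0 ≤ σ → c ρ ≤ ENNReal.ofReal σ →
      u < ∫ y, ψ₀ y ∂ρ.1 + σ * α := fun ρ σ h0 h1 => by
    rw [← hl]
    exact hl2 _ (subset_closure ⟨ρ, rfl, h0, h1⟩)
  have hα : 0 ≤ α := by
    obtain ⟨⟨_, σ⟩, ρ, rfl, h0, h1⟩ := hA
    simp only at h0 h1
    by_contra! hneg
    obtain ⟨n, hn⟩ := exists_nat_gt ((∫ y, ψ₀ y ∂ρ.1 + σ * α - u) / (-α))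
    rw [div_lt_iff₀ (by linarith)] at hn
    have h2 := hl3 ρ (σ + n) (by positivity)
      (h1.trans (ENNReal.ofReal_le_ofReal (by simp)))
    nlinarith
  rcases hα.eq_or_lt with hα | hα
  · rw [← hα, mul_zero, add_zero] at hl1
    simp only [← hα, mul_zero, add_zero] at hl3
    obtain ⟨n, hn⟩ := exists_nat_gt (r / (u - ∫ y, ψ₀ y ∂ρ₀.1))
    rw [div_lt_iff₀ (by linarith)] at hn
    refine ⟨_, hψ₀.const_mul n, n * u, ?_, fun ρ σ h0 h1 => ?_⟩
    · rw [integral_const_mul]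
      linarith
    · rw [integral_const_mul]
      have := mul_le_mul_of_nonneg_left (hl3 ρ σ h0 h1).le (Nat.cast_nonneg (α := ℝ) n)
      linarith
  · refine ⟨_, hψ₀.const_mul α⁻¹, α⁻¹ * u, ?_, fun ρ σ h0 h1 => ?_⟩
    · rw [integral_const_mul, ← sub_pos]
      have := mul_pos (inv_pos.2 hα) (sub_pos.2 hl1)
      field_simp at this ⊢
      linarith
    · rw [integral_const_mul, ← sub_nonneg]
      have := mul_pos (inv_pos.2 hα) (sub_pos.2 (hl3 ρ σ h0 h1))
      field_simp at this ⊢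
      linarith

end Separation

section Representation

variable {X : Type*} [TopologicalSpace X] [PolishSpace X] [MeasurableSpace X] [BorelSpace X]
  {p : ℝ} {d : ℕ}

theorem exists_countable_representation_aux (hp : 1 ≤ p) (μ : Measure X) [IsFiniteMeasure μ]
    {c : X → Pp p d → ℝ≥0∞} (hc : LowerSemicontinuous fun q : X × Pp p d => c q.1 q.2)
    (hconv : ∀ x, ∀ ρ₁ ρ₂ : Pp p d, ∀ t : ℝ, ∀ h0 : 0 ≤ t, ∀ h1 : t ≤ 1,
      c x ⟨_, Pp.mix_mem ρ₁ ρ₂ h0 h1⟩ ≤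
        ENNReal.ofReal t * c x ρ₁ + ENNReal.ofReal (1 - t) * c x ρ₂) :
    ∃ (ψ : ℕ × ℕ → Rd d → ℝ) (f : ℕ × ℕ → X → ℝ), (∀ k, Cbp p (ψ k)) ∧ (∀ k, Measurable (f k)) ∧
      (∀ k, ∃ B : ℝ, ∀ x, |f k x| ≤ B) ∧
      ∀ᵐ x ∂μ, ∀ ρ : Pp p d, c x ρ = ⨆ k, ENNReal.ofReal (f k x - ∫ y, ψ k y ∂ρ.1) := by
  have hp0 : 0 ≤ p := by linarith
  obtain ⟨u, hu, huψ⟩ := exists_countable_upper_family (d := d) hp0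
  have hM : ∀ i, ∃ M : ℝ, 0 ≤ M ∧ ∀ y, -M ≤ u i y := fun i => by
    obtain ⟨b, hb⟩ := (hu i).2.1
    exact ⟨|b|, abs_nonneg b, fun y => (neg_abs_le b).trans (hb y)⟩
  choose M hM0 hM using hM
  have hui : ∀ i, ∀ ρ : Pp p d, Integrable (u i) ρ.1 := fun i =>
    ((hu i).growthP hp0).integrable_pp hp0
  have hMi : ∀ i, ∀ ρ : Pp p d, 0 ≤ ∫ y, u i y ∂ρ.1 + M i := fun i ρ => by
    have := integral_mono (integrable_const (-M i)) (hui i ρ) (hM i)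
    simp only [integral_const, probReal_univ, one_smul] at this
    linarith
  let g : ℕ → X × Pp p d → ℝ≥0∞ := fun i q =>
    c q.1 q.2 + ENNReal.ofReal (∫ y, u i y ∂q.2.1 + M i)
  have hg : ∀ i, LowerSemicontinuous (g i) := fun i => by
    refine hc.add (Continuous.lowerSemicontinuous ?_)
    exact ENNReal.continuous_ofReal.comp ((((hu i).growthP hp0).continuous_integral.comp
      continuous_snd).add continuous_const)
  have hq : ∀ i, AEMeasurable (fun x => ⨅ ρ : Pp p d, g i (x, ρ)) μ := fun i =>
    aemeasurable_iInf_Pp hp μ (hg i)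
  let F : ℕ × ℕ → X → ℝ := fun k x => (min ((hq k.1).mk _ x) k.2).toReal - M k.1
  refine ⟨fun k => u k.1, F, fun k => hu _, fun k => ?_, fun k => ⟨k.2 + M k.1, fun x => ?_⟩, ?_⟩
  · exact (((hq k.1).measurable_mk.min measurable_const).ennreal_toReal).sub_const _
  · have h1 : (min ((hq k.1).mk _ x) k.2).toReal ≤ k.2 := by
      have := ENNReal.toReal_mono (ENNReal.natCast_ne_top k.2) (min_le_right ((hq k.1).mk _ x) _)
      simpa using this
    have h2 : 0 ≤ (min ((hq k.1).mk _ x) k.2).toReal := ENNReal.toReal_nonneg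
    rw [abs_le]
    constructor <;> simp only [F] <;> linarith [hM0 k.1, Nat.cast_nonneg (α := ℝ) k.2]
  · filter_upwards [ae_all_iff.2 fun i => (hq i).ae_eq_mk] with x hx ρ
    have hF : ∀ k, F k x = (min (⨅ ρ : Pp p d, g k.1 (x, ρ)) k.2).toReal - M k.1 := fun k => by
      simp only [F, ← hx]
    refine le_antisymm (le_of_forall_lt fun r hr => ?_) (iSup_le fun k => ?_)
    · lift r to NNReal using hr.ne_top
      obtain ⟨r', hr1, hr2⟩ := ENNReal.lt_iff_exists_nnreal_btwn.1 hr
      refine hr1.trans_le ?_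
      obtain ⟨ψ, hψ, v, hv, hvs⟩ := exists_growthP_separating hp0
        (hc.comp (continuous_const.prodMk continuous_id) : LowerSemicontinuous (c x)) (hconv x) ρ
        r'.coe_nonneg (by simpa using hr2)
      obtain ⟨i, hi1, hi2⟩ := huψ ψ hψ ρ (v - (r' + ∫ y, ψ y ∂ρ.1)) (by linarith)
      obtain ⟨n, hn⟩ := exists_nat_ge (v + M i)
      have h1 : ENNReal.ofReal (v + M i) ≤ min (⨅ ρ : Pp p d, g i (x, ρ)) n := by
        refine le_min (le_iInf fun ρ' => ?_) ?_
        · simp only [g]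
          rcases eq_or_ne (c x ρ') ⊤ with h | h
          · simp [h]
          · rw [← ENNReal.ofReal_toReal h, ← ENNReal.ofReal_add ENNReal.toReal_nonneg (hMi i ρ')]
            refine ENNReal.ofReal_le_ofReal ?_
            have h2 := hvs ρ' _ ENNReal.toReal_nonneg (ENNReal.ofReal_toReal h).ge
            have h3 := integral_mono (hψ.integrable_pp hp0 ρ') (hui i ρ') hi1
            linarith
        · rw [← ENNReal.ofReal_natCast]
          exact ENNReal.ofReal_le_ofReal hn
      have h2 : v + M i ≤ (min (⨅ ρ : Pp p d, g i (x, ρ)) n).toReal :=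
        (ENNReal.ofReal_le_iff_le_toReal
          (ne_top_of_le_ne_top (ENNReal.natCast_ne_top n) (min_le_right _ _))).1 h1
      refine le_iSup_of_le (i, n) ?_
      rw [hF, ← ENNReal.ofReal_coe_nnreal]
      refine ENNReal.ofReal_le_ofReal ?_
      simp only
      linarith
    · rcases eq_or_ne (c x ρ) ⊤ with h | h
      · simp [h]
      · have h1 : (min (⨅ ρ : Pp p d, g k.1 (x, ρ)) k.2).toReal ≤ (g k.1 (x, ρ)).toReal :=
          ENNReal.toReal_mono (ENNReal.add_ne_top.2 ⟨h, ENNReal.ofReal_ne_top⟩)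
            ((min_le_left _ _).trans (iInf_le _ ρ))
        simp only [g] at h1
        rw [ENNReal.toReal_add h ENNReal.ofReal_ne_top, ENNReal.toReal_ofReal (hMi k.1 ρ)] at h1
        refine (ENNReal.ofReal_le_ofReal (?_ : _ ≤ (c x ρ).toReal)).trans
          (ENNReal.ofReal_toReal h).le
        rw [hF]
        linarith

/-- A nonnegative lower semicontinuous cost, convex in its second argument, is almost everywhere
a countable supremum of costs which are affine in the second argument. -/
theorem exists_countable_representation (hp : 1 ≤ p) (μ : Measure X) [IsFiniteMeasure μ]
    {c : X → Pp p d → ℝ≥0∞} (hc : LowerSemicontinuous fun q : X × Pp p d => c q.1 q.2)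
    (hconv : ∀ x, ∀ ρ₁ ρ₂ : Pp p d, ∀ t : ℝ, ∀ h0 : 0 ≤ t, ∀ h1 : t ≤ 1,
      c x ⟨_, Pp.mix_mem ρ₁ ρ₂ h0 h1⟩ ≤
        ENNReal.ofReal t * c x ρ₁ + ENNReal.ofReal (1 - t) * c x ρ₂) :
    ∃ (ψ : ℕ → Rd d → ℝ) (f : ℕ → X → ℝ), (∀ k, Cbp p (ψ k)) ∧ (∀ k, Measurable (f k)) ∧
      (∀ k, ∃ B : ℝ, ∀ x, |f k x| ≤ B) ∧ (∀ y, ψ 0 y = 0) ∧ (∀ x, f 0 x = 0) ∧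
      ∀ᵐ x ∂μ, ∀ ρ : Pp p d, c x ρ = ⨆ k, ENNReal.ofReal (f k x - ∫ y, ψ k y ∂ρ.1) := by
  obtain ⟨ψ, f, h1, h2, h3, h4⟩ := exists_countable_representation_aux hp μ hc hconv
  let ψ' : ℕ → Rd d → ℝ := fun n => n.casesOn (fun _ => 0) fun k => ψ k.unpair
  let f' : ℕ → X → ℝ := fun n => n.casesOn (fun _ => 0) fun k => f k.unpair
  refine ⟨ψ', f', ?_, ?_, ?_, fun y => rfl, fun x => rfl, ?_⟩
  · rintro (_ | k)
    exacts [cbp_const 0, h1 _]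
  · rintro (_ | k)
    exacts [measurable_const, h2 _]
  · rintro (_ | k)
    exacts [⟨0, fun x => by simp [f']⟩, h3 _]
  · filter_upwards [h4] with x hx ρ
    rw [hx]
    refine le_antisymm (iSup_le fun k => le_iSup_of_le (Nat.pair k.1 k.2 + 1) ?_)
      (iSup_le fun n => ?_)
    · simp [f', ψ']
    · rcases n with _ | n
      · simp [f', ψ']
      · exact le_iSup (fun k => ENNReal.ofReal (f k x - ∫ y, ψ k y ∂ρ.1)) n.unpair

end Representation

section LinearFunctional

variable {X : Type*} [MeasurableSpace X] {p : ℝ} {d : ℕ}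

/-- Measurable functions on `X × ℝ^d` of growth of order `p` in the second variable, uniformly in
the first one. -/
def crossGrowth (X : Type*) [MeasurableSpace X] (p : ℝ) (d : ℕ) : Submodule ℝ (X × Rd d → ℝ) where
  carrier := {h | Measurable h ∧ ∃ K : ℝ, ∀ x y, |h (x, y)| ≤ K * (1 + ‖y‖ ^ p)}
  zero_mem' := ⟨measurable_const, 0, fun x y => by simp⟩
  add_mem' := by
    rintro f g ⟨hf, K, hK⟩ ⟨hg, M, hM⟩
    refine ⟨hf.add hg, K + M, fun x y => (abs_add_le _ _).trans ?_⟩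
    rw [add_mul]
    exact add_le_add (hK x y) (hM x y)
  smul_mem' := by
    rintro r f ⟨hf, K, hK⟩
    refine ⟨hf.const_smul r, |r| * K, fun x y => ?_⟩
    rw [Pi.smul_apply, smul_eq_mul, abs_mul, mul_assoc]
    exact mul_le_mul_of_nonneg_left (hK x y) (abs_nonneg r)

theorem integrable_of_mem_crossGrowth (hp : 0 ≤ p) {h : X × Rd d → ℝ} (hh : h ∈ crossGrowth X p d)
    (x : X) (ρ : Pp p d) : Integrable (fun y => h (x, y)) ρ.1 := by
  obtain ⟨hm, K, hK⟩ := hh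
  exact ((ρ.2.2.integrable_weight hp).const_mul K).mono'
    (hm.comp measurable_prodMk_left).aestronglyMeasurable (Eventually.of_forall (hK x))

/-- The set of upper estimates of `h` by separated potentials and multiples of the cost. -/
def potentialValues (μ : Measure X) (ν : Measure (Rd d)) (c : X → Pp p d → ℝ≥0∞) (D : ℝ)
    (h : X × Rd d → ℝ) : Set ℝ :=
  {v | ∃ (t : ℝ) (ψ : Rd d → ℝ) (F : X → ℝ), 0 ≤ t ∧ Cbp p ψ ∧ Integrable F μ ∧
    (∀ᵐ x ∂μ, ∀ ρ : Pp p d, ENNReal.ofReal (F x + ∫ y, h (x, y) ∂ρ.1 - ∫ y, ψ y ∂ρ.1) ≤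
      ENNReal.ofReal t * c x ρ) ∧ v = ∫ y, ψ y ∂ν - ∫ x, F x ∂μ + t * D}

variable {μ : Measure X} {ν : Measure (Rd d)} {c : X → Pp p d → ℝ≥0∞} {D : ℝ}

theorem le_mul_of_forall_potential (hp : 0 ≤ p) [IsProbabilityMeasure ν]
    (H : ∀ φ : Rd d → ℝ, Cbp p φ → ∀ F : X → ℝ, Integrable F μ →
      (∀ᵐ x ∂μ, ∀ ρ : Pp p d, ENNReal.ofReal (F x - ∫ y, φ y ∂ρ.1) ≤ c x ρ) →
      ∫ x, F x ∂μ ≤ D + ∫ y, φ y ∂ν)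
    {φ : Rd d → ℝ} (hφ : Cbp p φ) {F : X → ℝ} (hF : Integrable F μ) {t : ℝ} (ht : 0 ≤ t)
    (h : ∀ᵐ x ∂μ, ∀ ρ : Pp p d, ENNReal.ofReal (F x - ∫ y, φ y ∂ρ.1) ≤ ENNReal.ofReal t * c x ρ) :
    ∫ x, F x ∂μ ≤ t * D + ∫ y, φ y ∂ν := by
  have key : ∀ s : ℝ, 0 < s → t ≤ s → ∫ x, F x ∂μ ≤ s * D + ∫ y, φ y ∂ν := by
    intro s hs hts
    have h1 := H _ (hφ.const_mul hp (inv_nonneg.2 hs.le)) _ (hF.const_mul s⁻¹) ?_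
    · rw [integral_const_mul, integral_const_mul] at h1
      have h2 := mul_le_mul_of_nonneg_left h1 hs.le
      rw [mul_add, mul_inv_cancel_left₀ hs.ne', mul_inv_cancel_left₀ hs.ne'] at h2
      exact h2
    · filter_upwards [h] with x hx ρ
      rw [integral_const_mul, ← mul_sub, ENNReal.ofReal_mul (inv_nonneg.2 hs.le)]
      refine (mul_le_mul_right ((hx ρ).trans
        (mul_le_mul_left (ENNReal.ofReal_le_ofReal hts) _)) _).trans ?_
      rw [← mul_assoc, ← ENNReal.ofReal_mul (inv_nonneg.2 hs.le), inv_mul_cancel₀ hs.ne',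
        ENNReal.ofReal_one, one_mul]
  rcases ht.eq_or_lt with rfl | ht'
  · have hlim : Tendsto (fun s : ℝ => s * D + ∫ y, φ y ∂ν) (𝓝[>] 0) (𝓝 (0 * D + ∫ y, φ y ∂ν)) :=
      ((continuous_id.mul continuous_const).add continuous_const).continuousWithinAt
    exact ge_of_tendsto hlim (eventually_mem_nhdsWithin.mono fun s hs => key s hs hs.le)
  · exact key t ht' le_rfl

/-- The Mazur–Orlicz step: the duality inequality yields a linear functional on
`crossGrowth X p d` which has marginals `μ` and `ν` and is compatible with the cost. -/
theorem exists_linear_functional (hp : 0 ≤ p) [IsProbabilityMeasure μ] [IsProbabilityMeasure ν]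
    (hν : HasMomentP p ν)
    (H : ∀ φ : Rd d → ℝ, Cbp p φ → ∀ F : X → ℝ, Integrable F μ →
      (∀ᵐ x ∂μ, ∀ ρ : Pp p d, ENNReal.ofReal (F x - ∫ y, φ y ∂ρ.1) ≤ c x ρ) →
      ∫ x, F x ∂μ ≤ D + ∫ y, φ y ∂ν) :
    ∃ L : crossGrowth X p d →ₗ[ℝ] ℝ,
      (∀ (h : crossGrowth X p d) (a : X → ℝ) (ψ : Rd d → ℝ), Integrable a μ → Cbp p ψ →
        (∀ x y, h.1 (x, y) ≤ a x + ψ y) → L h ≤ ∫ x, a x ∂μ + ∫ y, ψ y ∂ν) ∧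
      ∀ (h : crossGrowth X p d) (F : X → ℝ), Integrable F μ →
        (∀ᵐ x ∂μ, ∀ ρ : Pp p d, ENNReal.ofReal (F x - ∫ y, h.1 (x, y) ∂ρ.1) ≤ c x ρ) →
        ∫ x, F x ∂μ ≤ D + L h := by
  let S : crossGrowth X p d → Set ℝ := fun h => potentialValues μ ν c D h.1
  have hint : ∀ {ψ : Rd d → ℝ}, Cbp p ψ → ∀ ρ : Pp p d, Integrable ψ ρ.1 := fun hψ =>
    (hψ.growthP hp).integrable_pp hp
  have hintν : ∀ {ψ : Rd d → ℝ}, Cbp p ψ → Integrable ψ ν := fun hψ =>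
    (hψ.growthP hp).integrable hp hν
  have hinth := fun h : crossGrowth X p d => integrable_of_mem_crossGrowth hp h.2
  have hK : ∀ h : crossGrowth X p d, ∃ K : ℝ, 0 ≤ K ∧ ∀ x y, |h.1 (x, y)| ≤ K * (1 + ‖y‖ ^ p) := by
    rintro ⟨h, hm, K, hK⟩
    exact ⟨|K|, abs_nonneg K, fun x y => (hK x y).trans
      (mul_le_mul_of_nonneg_right (le_abs_self K) (by linarith [one_le_weight p y]))⟩
  have hne : ∀ h, (S h).Nonempty := fun h => by
    obtain ⟨K, hK0, hK⟩ := hK h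
    refine ⟨_, 0, _, fun _ => 0, le_rfl, (cbp_weight hp).const_mul hp hK0, integrable_const _,
      Eventually.of_forall fun x ρ => ?_, rfl⟩
    rw [ENNReal.ofReal_of_nonpos]
    · exact zero_le
    · have := integral_mono (hinth h x ρ) (hint ((cbp_weight hp).const_mul hp hK0) ρ)
        fun y => (le_abs_self _).trans (hK x y)
      linarith
  have hbdd : ∀ h, BddBelow (S h) := fun h => by
    obtain ⟨K, hK0, hK⟩ := hK h
    refine ⟨-∫ y, K * (1 + ‖y‖ ^ p) ∂ν, ?_⟩
    rintro _ ⟨t, ψ, F, ht, hψ, hF, h1, rfl⟩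
    have hw := (cbp_weight (d := d) hp).const_mul hp hK0
    have h2 := le_mul_of_forall_potential hp H (hψ.add hp hw) hF ht ?_
    · rw [integral_add (hintν hψ) (hintν hw)] at h2
      linarith
    · filter_upwards [h1] with x hx ρ
      refine (ENNReal.ofReal_le_ofReal ?_).trans (hx ρ)
      rw [integral_add (hint hψ ρ) (hint hw ρ)]
      have := integral_mono (hint hw ρ).neg (hinth h x ρ) fun y => (abs_le.1 (hK x y)).1
      simp only [Pi.neg_apply, integral_neg] at this
      linarith
  have hadd : ∀ h₁ h₂ v₁ v₂, v₁ ∈ S h₁ → v₂ ∈ S h₂ → v₁ + v₂ ∈ S (h₁ + h₂) := by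
    rintro h₁ h₂ _ _ ⟨t₁, ψ₁, F₁, ht₁, hψ₁, hF₁, e₁, rfl⟩ ⟨t₂, ψ₂, F₂, ht₂, hψ₂, hF₂, e₂, rfl⟩
    refine ⟨t₁ + t₂, _, _, add_nonneg ht₁ ht₂, hψ₁.add hp hψ₂, hF₁.add hF₂, ?_, ?_⟩
    · filter_upwards [e₁, e₂] with x hx₁ hx₂ ρ
      rw [ENNReal.ofReal_add ht₁ ht₂, add_mul]
      refine le_trans ?_ (add_le_add (hx₁ ρ) (hx₂ ρ))
      refine le_trans (ENNReal.ofReal_le_ofReal (le_of_eq ?_)) ENNReal.ofReal_add_le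
      simp only [Submodule.coe_add, Pi.add_apply]
      rw [integral_add (hinth h₁ x ρ) (hinth h₂ x ρ), integral_add (hint hψ₁ ρ) (hint hψ₂ ρ)]
      ring
    · simp only [Pi.add_apply]
      rw [integral_add (hintν hψ₁) (hintν hψ₂), integral_add hF₁ hF₂]
      ring
  have hsmul : ∀ r : ℝ, 0 < r → ∀ h v, v ∈ S h → r * v ∈ S (r • h) := by
    rintro r hr h _ ⟨t, ψ, F, ht, hψ, hF, e, rfl⟩
    refine ⟨r * t, _, _, mul_nonneg hr.le ht, hψ.const_mul hp hr.le, hF.const_mul r, ?_, ?_⟩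
    · filter_upwards [e] with x hx ρ
      simp only [Submodule.coe_smul, Pi.smul_apply, smul_eq_mul, integral_const_mul]
      rw [← mul_add, ← mul_sub, ENNReal.ofReal_mul hr.le, ENNReal.ofReal_mul hr.le, mul_assoc]
      exact mul_le_mul_right (hx ρ) _
    · simp only [integral_const_mul]
      ring
  have hle_smul : ∀ r : ℝ, 0 < r → ∀ h, sInf (S (r • h)) ≤ r * sInf (S h) := fun r hr h => by
    rw [← div_le_iff₀' hr]
    refine le_csInf (hne h) fun v hv => ?_
    rw [div_le_iff₀' hr]
    exact csInf_le (hbdd _) (hsmul r hr h v hv)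
  obtain ⟨L, -, hL⟩ := exists_extension_of_le_sublinear
    (⟨⊥, 0⟩ : crossGrowth X p d →ₗ.[ℝ] ℝ) (fun h => sInf (S h)) (fun r hr h => by
      refine le_antisymm (hle_smul r hr h) ?_
      have := hle_smul r⁻¹ (inv_pos.2 hr) (r • h)
      rw [inv_smul_smul₀ hr.ne'] at this
      rwa [← le_inv_mul_iff₀ hr]) (fun h₁ h₂ => by
      rw [← sub_le_iff_le_add]
      refine le_csInf (hne h₁) fun v₁ hv₁ => ?_
      rw [sub_le_comm]
      refine le_csInf (hne h₂) fun v₂ hv₂ => ?_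
      rw [sub_le_iff_le_add']
      exact csInf_le (hbdd _) (hadd _ _ _ _ hv₁ hv₂)) (by
      rintro ⟨h, hh⟩
      obtain rfl := (Submodule.mem_bot ℝ).1 hh
      simp only [LinearPMap.mk_apply, LinearMap.zero_apply]
      refine le_csInf (hne 0) ?_
      rintro _ ⟨t, ψ, F, ht, hψ, hF, e, rfl⟩
      have := le_mul_of_forall_potential hp H hψ hF ht (by simpa using e)
      linarith)
  refine ⟨L, fun h a ψ ha hψ hle => (hL h).trans (csInf_le (hbdd h)
    ⟨0, ψ, fun x => -a x, le_rfl, hψ, ha.neg, Eventually.of_forall fun x ρ => ?_, ?_⟩),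
    fun h F hF e => ?_⟩
  · rw [ENNReal.ofReal_of_nonpos]
    · exact zero_le
    · have := integral_mono (hinth h x ρ) ((integrable_const (a x)).add (hint hψ ρ)) (hle x)
      simp only [Pi.add_apply] at this
      rw [integral_add (integrable_const (a x)) (hint hψ ρ)] at this
      simp only [integral_const, probReal_univ, one_smul] at this
      linarith
  · rw [integral_neg]
    ring
  · have h1 : L (-h) ≤ _ := (hL (-h)).trans (csInf_le (hbdd (-h))
      ⟨1, fun _ => 0, F, zero_le_one, cbp_const 0, hF, ?_, rfl⟩)
    · rw [map_neg] at h1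
      simp only [integral_zero] at h1
      linarith
    · filter_upwards [e] with x hx ρ
      rw [ENNReal.ofReal_one, one_mul]
      refine (ENNReal.ofReal_le_ofReal (le_of_eq ?_)).trans (hx ρ)
      simp only [Submodule.coe_neg, Pi.neg_apply, integral_neg, integral_zero]
      ring

end LinearFunctional

section Representation

open scoped CompactlySupported

variable {X : Type*} [MeasurableSpace X] {p : ℝ} {d : ℕ}

/-- A linear functional on `crossGrowth X p d` is dominated by the marginals `μ` and `ν`. -/
def HasMarginals (L : crossGrowth X p d →ₗ[ℝ] ℝ) (μ : Measure X) (ν : Measure (Rd d)) : Prop :=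
  ∀ (h : crossGrowth X p d) (a : X → ℝ) (ψ : Rd d → ℝ), Integrable a μ → Cbp p ψ →
    (∀ x y, h.1 (x, y) ≤ a x + ψ y) → L h ≤ ∫ x, a x ∂μ + ∫ y, ψ y ∂ν

variable {μ : Measure X} {ν : Measure (Rd d)} {L : crossGrowth X p d →ₗ[ℝ] ℝ}

theorem HasMarginals.abs_sub_le (hL : HasMarginals L μ ν) {h h' : crossGrowth X p d}
    {a : X → ℝ} {ψ : Rd d → ℝ} (ha : Integrable a μ) (hψ : Cbp p ψ)
    (hle : ∀ x y, |h.1 (x, y) - h'.1 (x, y)| ≤ a x + ψ y) :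
    |L h - L h'| ≤ ∫ x, a x ∂μ + ∫ y, ψ y ∂ν := by
  rw [abs_le', neg_sub, ← map_sub, ← map_sub]
  exact ⟨hL _ _ _ ha hψ fun x y => (le_abs_self _).trans (hle x y),
    hL _ _ _ ha hψ fun x y => (le_abs_self _).trans ((abs_sub_comm _ _).trans_le (hle x y))⟩

theorem HasMarginals.nonneg (hL : HasMarginals L μ ν) {h : crossGrowth X p d}
    (hh : ∀ x y, 0 ≤ h.1 (x, y)) : 0 ≤ L h := by
  have := hL (-h) (fun _ => 0) (fun _ => 0) (integrable_zero _ _ _) (cbp_const 0)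
    fun x y => by simpa using hh x y
  rw [map_neg, integral_zero, integral_zero] at this
  linarith

theorem mem_crossGrowth_of_bounded {h : X × Rd d → ℝ} (hm : Measurable h) {B : ℝ}
    (hB : ∀ q, |h q| ≤ B) : h ∈ crossGrowth X p d :=
  ⟨hm, |B|, fun _ y => (hB _).trans <| (le_abs_self B).trans <|
    le_mul_of_one_le_right (abs_nonneg B) (one_le_weight p y)⟩

theorem isFiniteMeasure_of_forall_integral_radialCutoff {Y : Type*} [MeasurableSpace Y]
    {m : Measure (Y × Rd d)} {B : ℝ}
    (hi : ∀ R : ℕ, Integrable (fun q : Y × Rd d => radialCutoff d R q.2) m)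
    (hB : ∀ R : ℕ, ∫ q, radialCutoff d R q.2 ∂m ≤ B) : IsFiniteMeasure m := by
  refine ⟨lt_of_le_of_lt ?_ (ENNReal.ofReal_lt_top (r := B))⟩
  calc m univ = ∫⁻ q : Y × Rd d,
          liminf (fun R : ℕ => ENNReal.ofReal (radialCutoff d R q.2)) atTop ∂m := by
        rw [← lintegral_one]
        refine lintegral_congr fun q => ?_
        rw [(ENNReal.tendsto_ofReal (tendsto_radialCutoff q.2)).liminf_eq, ENNReal.ofReal_one]
    _ ≤ liminf (fun R : ℕ => ∫⁻ q : Y × Rd d, ENNReal.ofReal (radialCutoff d R q.2) ∂m) atTop :=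
        lintegral_liminf_le fun R => ((continuous_radialCutoff (d := d) R).measurable.comp
          measurable_snd).ennreal_ofReal
    _ ≤ ENNReal.ofReal B := by
        refine liminf_le_of_le (by isBoundedDefault) fun b hb => ?_
        obtain ⟨R, hR⟩ := hb.exists
        refine hR.trans ?_
        rw [← ofReal_integral_eq_lintegral_ofReal (hi R)
          (Eventually.of_forall fun q => radialCutoff_nonneg R q.2)]
        exact ENNReal.ofReal_le_ofReal (hB R)

theorem exists_measure_of_hasMarginals (hp : 0 ≤ p) [IsProbabilityMeasure μ]
    [IsProbabilityMeasure ν] (hν : HasMomentP p ν) (hL : HasMarginals L μ ν)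
    {e : X → unitInterval} (he : Measurable e) :
    ∃ m : Measure (unitInterval × Rd d), IsFiniteMeasure m ∧ m.map Prod.fst = μ.map e ∧
      m.map Prod.snd = ν ∧
      ∀ v : unitInterval × Rd d → ℝ, Continuous v → HasCompactSupport v →
        ∀ h : crossGrowth X p d, (∀ x y, h.1 (x, y) = v (e x, y)) → L h = ∫ q, v q ∂m := by
  have hmem : ∀ v : C_c(unitInterval × Rd d, ℝ),
      (fun q : X × Rd d => v (e q.1, q.2)) ∈ crossGrowth X p d := fun v => by
    obtain ⟨B, hB⟩ := v.hasCompactSupport.exists_bound_of_continuous v.continuous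
    refine mem_crossGrowth_of_bounded (B := B) ?_ fun q => hB _
    exact v.continuous.measurable.comp ((he.comp measurable_fst).prodMk measurable_snd)
  let Λ₀ : C_c(unitInterval × Rd d, ℝ) →ₗ[ℝ] ℝ :=
    { toFun := fun v => L ⟨_, hmem v⟩
      map_add' := fun v w => by rw [← map_add]; rfl
      map_smul' := fun r v => by rw [← map_smul]; rfl }
  let Λ := PositiveLinearMap.mk₀ Λ₀ fun v hv => hL.nonneg fun x y =>
    show (0 : C_c(unitInterval × Rd d, ℝ)) (e x, y) ≤ v (e x, y) from
      CompactlySupportedContinuousMap.le_def.1 hv (e x, y)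
  let m := RealRMK.rieszMeasure Λ
  have hm : ∀ v : unitInterval × Rd d → ℝ, Continuous v → HasCompactSupport v →
      ∀ h : crossGrowth X p d, (∀ x y, h.1 (x, y) = v (e x, y)) → L h = ∫ q, v q ∂m := by
    intro v hv hvc h hh
    refine Eq.trans (congrArg L ?_) (RealRMK.integral_rieszMeasure Λ ⟨⟨v, hv⟩, hvc⟩).symm
    exact Subtype.ext (funext fun q => hh q.1 q.2)
  have hcs : ∀ (k : unitInterval × Rd d → ℝ) (R : ℕ),
      HasCompactSupport fun q : unitInterval × Rd d => k q * radialCutoff d R q.2 := fun k R =>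
    HasCompactSupport.intro (isCompact_univ.prod (isCompact_closedBall (0 : Rd d) (R + 1)))
      fun q hq => by
        rw [radialCutoff_eq_zero, mul_zero]
        simpa using (not_le.1 (by simpa using hq)).le
  have hcont : ∀ (k : unitInterval × Rd d → ℝ), Continuous k → ∀ R : ℕ,
      Continuous fun q : unitInterval × Rd d => k q * radialCutoff d R q.2 := fun k hk R =>
    hk.mul ((continuous_radialCutoff R).comp continuous_snd)
  have hbd : ∀ (k : unitInterval × Rd d → ℝ) (B : ℝ), (∀ q, |k q| ≤ B) → ∀ (R : ℕ) q,
      |k q * radialCutoff d R q.2| ≤ B := fun k B hB R q => by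
    rw [abs_mul, abs_of_nonneg (radialCutoff_nonneg _ _)]
    exact (mul_le_of_le_one_right (abs_nonneg _) (radialCutoff_le_one _ _)).trans (hB q)
  have hmemR : ∀ (k : unitInterval × Rd d → ℝ), Continuous k → ∀ B : ℝ, (∀ q, |k q| ≤ B) →
      ∀ R : ℕ, (fun q : X × Rd d => k (e q.1, q.2) * radialCutoff d R q.2) ∈ crossGrowth X p d :=
    fun k hk B hB R => mem_crossGrowth_of_bounded (B := B)
      ((hcont k hk R).measurable.comp ((he.comp measurable_fst).prodMk measurable_snd))
      fun q => hbd k B hB R (e q.1, q.2)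
  have hfin : IsFiniteMeasure m := by
    refine isFiniteMeasure_of_forall_integral_radialCutoff (B := 1) (fun R => ?_) fun R => ?_
    · have := (hcont (fun _ => 1) continuous_const R).integrable_of_hasCompactSupport (μ := m)
        (hcs _ R)
      simpa only [one_mul] using this
    · have h1 := hm _ (hcont (fun _ => 1) continuous_const R) (hcs _ R)
        ⟨_, hmemR (fun _ => 1) continuous_const 1 (by simp) R⟩ fun _ _ => rfl
      simp only [one_mul] at h1
      rw [← h1]
      refine (hL _ (fun _ => 0) (fun _ => 1) (integrable_zero _ _ _) (cbp_const 1)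
        fun x y => ?_).trans ?_
      · simpa using radialCutoff_le_one (R : ℝ) y
      · simp
  have hsum : ∀ (v : unitInterval → ℝ) (u : Rd d → ℝ), Continuous v → Continuous u →
      (∃ B, ∀ y, |u y| ≤ B) →
      ∫ q, (v q.1 + u q.2) ∂m = ∫ x, v (e x) ∂μ + ∫ y, u y ∂ν := by
    rintro v u hv hu ⟨B, hB⟩
    obtain ⟨A, hA⟩ := isCompact_univ.exists_bound_of_continuousOn hv.continuousOn
    have hA' : ∀ s, |v s| ≤ A := fun s => hA s (mem_univ s)
    have hk : Continuous fun q : unitInterval × Rd d => v q.1 + u q.2 := by fun_prop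
    have hkB : ∀ q : unitInterval × Rd d, |v q.1 + u q.2| ≤ A + B := fun q =>
      (abs_add_le _ _).trans (add_le_add (hA' _) (hB _))
    have hAB : 0 ≤ A + B := (abs_nonneg _).trans (hkB (0, 0))
    have hlim₁ : Tendsto (fun R : ℕ => ∫ q, (v q.1 + u q.2) * radialCutoff d R q.2 ∂m) atTop
        (𝓝 (∫ q, (v q.1 + u q.2) * 1 ∂m)) := by
      refine tendsto_integral_of_dominated_convergence (fun _ => A + B)
        (fun R => (hcont _ hk R).aestronglyMeasurable) (integrable_const _)
        (fun R => Eventually.of_forall (hbd _ _ hkB R))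
        (Eventually.of_forall fun q => (tendsto_radialCutoff q.2).const_mul _)
    have hvi : Integrable (fun x => v (e x)) μ :=
      (integrable_const A).mono' (hv.measurable.comp he).aestronglyMeasurable
        (Eventually.of_forall fun x => hA' _)
    have hui : Integrable u ν :=
      (integrable_const B).mono' hu.aestronglyMeasurable (Eventually.of_forall hB)
    have hlim₂ : Tendsto (fun R : ℕ => ∫ q, (v q.1 + u q.2) * radialCutoff d R q.2 ∂m) atTop
        (𝓝 (∫ x, v (e x) ∂μ + ∫ y, u y ∂ν)) := by
      have hw : Integrable (fun _ : Rd d => A + B) ν := integrable_const _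
      have hz := tendsto_integral_one_sub_radialCutoff_mul hw
      have hg : ∀ R : ℕ, Cbp p fun y : Rd d => (1 - radialCutoff d R y) * (A + B) := fun R =>
        GrowthP.cbp (c := 0) (GrowthP.of_le_of_le (growthP_const 0) (growthP_const (A + B))
          ((continuous_const.sub (continuous_radialCutoff R)).mul continuous_const)
          (fun y => mul_nonneg (sub_nonneg.2 (radialCutoff_le_one _ _)) hAB)
          (fun y => mul_le_of_le_one_left hAB (by linarith [radialCutoff_nonneg (R : ℝ) y])))
          (fun y => mul_nonneg (sub_nonneg.2 (radialCutoff_le_one _ _)) hAB)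
      have hub : Cbp p u := GrowthP.cbp (c := -B) (GrowthP.of_le_of_le (growthP_const (-B))
        (growthP_const B) hu (fun y => (abs_le.1 (hB y)).1) (fun y => (abs_le.1 (hB y)).2))
        (fun y => (abs_le.1 (hB y)).1)
      have hub' : Cbp p (fun y => -u y) := GrowthP.cbp (c := -B)
        (GrowthP.of_le_of_le (growthP_const (-B))
        (growthP_const B) hu.neg (fun y => by have := (abs_le.1 (hB y)).2; linarith)
        (fun y => by have := (abs_le.1 (hB y)).1; linarith))
        (fun y => by have := (abs_le.1 (hB y)).2; linarith)
      rw [tendsto_iff_dist_tendsto_zero]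
      refine squeeze_zero (fun _ => dist_nonneg) (fun R => ?_) hz
      have hgi := ((hg R).growthP hp).integrable hp hν
      have hpt : ∀ q : unitInterval × Rd d,
          |(v q.1 + u q.2) * radialCutoff d R q.2 - (v q.1 + u q.2)| ≤
            (1 - radialCutoff d R q.2) * (A + B) := fun q => by
        rw [← mul_sub_one, abs_mul, abs_sub_comm,
          abs_of_nonneg (sub_nonneg.2 (radialCutoff_le_one _ _)), mul_comm]
        exact mul_le_mul_of_nonneg_left (hkB q) (sub_nonneg.2 (radialCutoff_le_one _ _))
      rw [← hm _ (hcont _ hk R) (hcs _ R) ⟨_, hmemR _ hk _ hkB R⟩ fun _ _ => rfl, Real.dist_eq,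
        abs_le']
      constructor
      · have := hL ⟨_, hmemR _ hk _ hkB R⟩ _ _ hvi (hub.add hp (hg R)) fun x y => by
          have := (abs_le.1 (hpt (e x, y))).2
          simp only at this ⊢
          linarith
        rw [integral_add hui hgi] at this
        linarith
      · have := hL (-⟨_, hmemR _ hk _ hkB R⟩) _ _ hvi.neg (hub'.add hp (hg R)) fun x y => by
          have := (abs_le.1 (hpt (e x, y))).1
          simp only [Submodule.coe_neg, Pi.neg_apply] at this ⊢
          linarith
        have hui' : Integrable (fun y => -u y) ν := hui.neg
        rw [integral_add hui' hgi, map_neg] at this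
        simp only [Pi.neg_apply, integral_neg] at this
        linarith
    simpa using tendsto_nhds_unique hlim₁ hlim₂
  have hμe : IsProbabilityMeasure (μ.map e) := Measure.isProbabilityMeasure_map he.aemeasurable
  refine ⟨m, hfin, ?_, ?_, hm⟩
  · refine ext_of_forall_integral_eq_of_IsFiniteMeasure fun v => ?_
    rw [integral_map measurable_fst.aemeasurable v.continuous.aestronglyMeasurable,
      integral_map he.aemeasurable v.continuous.aestronglyMeasurable]
    simpa using hsum v (fun _ => 0) v.continuous continuous_const ⟨0, by simp⟩
  · refine ext_of_forall_integral_eq_of_IsFiniteMeasure fun u => ?_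
    rw [integral_map measurable_snd.aemeasurable u.continuous.aestronglyMeasurable]
    simpa using hsum (fun _ => 0) u continuous_const u.continuous ⟨‖u‖, u.norm_coe_le_norm⟩

end Representation

section Coupling

variable {X : Type*} [MeasurableSpace X] {p : ℝ} {d : ℕ}
  {μ : Measure X} {ν : Measure (Rd d)} {π : Measure (X × Rd d)}

theorem IsCoupling.integrable_fst (hπ : IsCoupling π μ ν) {a : X → ℝ} (ha : Integrable a μ) :
    Integrable (fun q => a q.1) π :=
  (hπ.2.1 ▸ ha : Integrable a (π.map Prod.fst)).comp_measurable measurable_fst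

theorem IsCoupling.integrable_snd (hπ : IsCoupling π μ ν) {ψ : Rd d → ℝ} (hψ : Integrable ψ ν) :
    Integrable (fun q => ψ q.2) π :=
  (hπ.2.2 ▸ hψ : Integrable ψ (π.map Prod.snd)).comp_measurable measurable_snd

theorem IsCoupling.integral_fst (hπ : IsCoupling π μ ν) {a : X → ℝ} (ha : Integrable a μ) :
    ∫ q, a q.1 ∂π = ∫ x, a x ∂μ := by
  have h := hπ.2.1
  subst h
  exact (integral_map measurable_fst.aemeasurable ha.1).symm

theorem IsCoupling.integral_snd (hπ : IsCoupling π μ ν) {ψ : Rd d → ℝ} (hψ : Integrable ψ ν) :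
    ∫ q, ψ q.2 ∂π = ∫ y, ψ y ∂ν := by
  have h := hπ.2.2
  subst h
  exact (integral_map measurable_snd.aemeasurable hψ.1).symm

theorem IsCoupling.integrable_crossGrowth (hπ : IsCoupling π μ ν) (hp : 0 ≤ p)
    [IsFiniteMeasure ν] (hν : HasMomentP p ν) {h : X × Rd d → ℝ} (hh : h ∈ crossGrowth X p d) :
    Integrable h π := by
  obtain ⟨hm, K, hK⟩ := hh
  exact ((hπ.integrable_snd (hν.integrable_weight hp)).const_mul K).mono' hm.aestronglyMeasurable
    (Eventually.of_forall fun q => hK q.1 q.2)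

/-- Integration against a coupling as a linear functional on `crossGrowth X p d`. -/
noncomputable def IsCoupling.integralLinear (hπ : IsCoupling π μ ν) (hp : 0 ≤ p)
    [IsFiniteMeasure ν] (hν : HasMomentP p ν) : crossGrowth X p d →ₗ[ℝ] ℝ where
  toFun h := ∫ q, h.1 q ∂π
  map_add' f g := integral_add (hπ.integrable_crossGrowth hp hν f.2)
    (hπ.integrable_crossGrowth hp hν g.2)
  map_smul' r _ := integral_const_mul r _

theorem IsCoupling.hasMarginals (hπ : IsCoupling π μ ν) (hp : 0 ≤ p)
    [IsFiniteMeasure ν] (hν : HasMomentP p ν) : HasMarginals (hπ.integralLinear hp hν) μ ν := by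
  intro h a ψ ha hψ hle
  have hψi := (hψ.growthP hp).integrable hp hν
  rw [← hπ.integral_fst ha, ← hπ.integral_snd hψi,
    ← integral_add (hπ.integrable_fst ha) (hπ.integrable_snd hψi)]
  exact integral_mono (hπ.integrable_crossGrowth hp hν h.2)
    ((hπ.integrable_fst ha).add (hπ.integrable_snd hψi)) fun q => hle q.1 q.2

theorem exists_coupling_of_map [StandardBorelSpace X] [IsProbabilityMeasure μ]
    [IsProbabilityMeasure ν] {e : X → unitInterval} (he : MeasurableEmbedding e)
    {m : Measure (unitInterval × Rd d)} (hm₁ : m.map Prod.fst = μ.map e)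
    (hm₂ : m.map Prod.snd = ν) :
    ∃ π : Measure (X × Rd d), IsCoupling π μ ν ∧ π.map (Prod.map e id) = m := by
  have hE : MeasurableEmbedding (Prod.map e (id : Rd d → Rd d)) := he.prodMap .id
  have hmap : (m.comap (Prod.map e id)).map (Prod.map e id) = m := by
    rw [hE.map_comap, Measure.restrict_eq_self_of_ae_mem]
    have h1 : ∀ᵐ s ∂(m.map Prod.fst), s ∈ range e := by
      rw [hm₁]
      exact (ae_map_iff he.measurable.aemeasurable he.measurableSet_range).2
        (Eventually.of_forall mem_range_self)
    filter_upwards [ae_of_ae_map measurable_fst.aemeasurable h1] with q hq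
    rw [range_prodMap]
    exact ⟨hq, by simp⟩
  refine ⟨m.comap (Prod.map e id), ?_, hmap⟩
  have h2 : (m.comap (Prod.map e id)).map Prod.snd = ν := by
    rw [← hm₂]
    conv_rhs => rw [← hmap, Measure.map_map measurable_snd hE.measurable]
    rfl
  refine ⟨?_, ?_, h2⟩
  · refine ⟨?_⟩
    have := measure_univ (μ := ν)
    rwa [← h2, Measure.map_apply measurable_snd .univ] at this
  · rw [← he.comap_map ((m.comap (Prod.map e id)).map Prod.fst), ← he.comap_map μ, ← hm₁,
      Measure.map_map he.measurable measurable_fst]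
    conv_rhs => rw [← hmap, Measure.map_map measurable_fst hE.measurable]
    rfl

theorem exists_coupling_of_hasMarginals [StandardBorelSpace X] (hp : 0 ≤ p)
    [IsProbabilityMeasure μ] [IsProbabilityMeasure ν] (hν : HasMomentP p ν)
    {L : crossGrowth X p d →ₗ[ℝ] ℝ} (hL : HasMarginals L μ ν) :
    ∃ π : Measure (X × Rd d), IsCoupling π μ ν ∧ ∀ (A : Set X) (ψ : Rd d → ℝ), MeasurableSet A →
      GrowthP p ψ → ∀ h : crossGrowth X p d,
        (∀ x y, h.1 (x, y) = A.indicator (fun _ => (1 : ℝ)) x * ψ y) → L h = ∫ q, h.1 q ∂π := by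
  have he := measurableEmbedding_sigmoid_comp_embeddingReal X
  set e := unitInterval.sigmoid ∘ embeddingReal X
  obtain ⟨m, hm, hm₁, hm₂, hmL⟩ := exists_measure_of_hasMarginals hp hν hL he.measurable
  obtain ⟨π, hπ, hπm⟩ := exists_coupling_of_map he hm₁ hm₂
  have hE : MeasurableEmbedding (Prod.map e (id : Rd d → Rd d)) := he.prodMap .id
  refine ⟨π, hπ, fun A ψ hA hψ h hh => ?_⟩
  obtain ⟨K, hK⟩ := hψ.2
  have hw1 : ∀ y : Rd d, 0 ≤ 1 + ‖y‖ ^ p := fun y => zero_le_one.trans (one_le_weight p y)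
  have hKw : ∀ y : Rd d, 0 ≤ K * (1 + ‖y‖ ^ p) := fun y => (abs_nonneg _).trans (hK y)
  have hwi : Integrable (fun y : Rd d => K * (1 + ‖y‖ ^ p)) ν :=
    (hν.integrable_weight hp).const_mul K
  refine eq_of_abs_sub_le_all fun ε hε => ?_
  obtain ⟨R, hR⟩ := ((tendsto_integral_one_sub_radialCutoff_mul hwi).eventually_lt_const
    (show (0 : ℝ) < ε / 4 by positivity)).exists
  obtain ⟨B, hB⟩ := ((hasCompactSupport_radialCutoff (d := d) R).mul_left (f := ψ)
    ).exists_bound_of_continuous (hψ.1.mul (continuous_radialCutoff R))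
  have hB0 : 0 ≤ B := (norm_nonneg _).trans (hB 0)
  have hμe : IsProbabilityMeasure (μ.map e) :=
    Measure.isProbabilityMeasure_map he.measurable.aemeasurable
  have hind : Integrable ((e '' A).indicator fun _ => (1 : ℝ)) (μ.map e) :=
    (integrable_const _).indicator (he.measurableSet_image.2 hA)
  obtain ⟨v, hv, hvi⟩ := hind.exists_boundedContinuous_integral_sub_le
    (show (0 : ℝ) < ε / 4 / (B + 1) by positivity)
  have hvm : ∀ x, (e '' A).indicator (fun _ => (1 : ℝ)) (e x) = A.indicator (fun _ => (1 : ℝ)) x :=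
    fun x => by
      by_cases hx : x ∈ A
      · rw [indicator_of_mem hx, indicator_of_mem (mem_image_of_mem e hx)]
      · rw [indicator_of_notMem hx,
          indicator_of_notMem fun h' => hx ((he.injective.mem_set_image).1 h')]
  have hai : Integrable (fun x => |A.indicator (fun _ => (1 : ℝ)) x - v (e x)|) μ := by
    have := ((hind.sub hvi).abs).comp_measurable he.measurable
    refine this.congr (Eventually.of_forall fun x => ?_)
    simp [Function.comp_apply, hvm]
  have hv' : ∫ x, |A.indicator (fun _ => (1 : ℝ)) x - v (e x)| ∂μ ≤ ε / 4 / (B + 1) := by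
    rw [he.integral_map] at hv
    simpa only [hvm, Real.norm_eq_abs] using hv
  let k : unitInterval × Rd d → ℝ := fun q => v q.1 * (ψ q.2 * radialCutoff d R q.2)
  have hk : Continuous k := (v.continuous.comp continuous_fst).mul
    ((hψ.1.mul (continuous_radialCutoff R)).comp continuous_snd)
  have hkc : HasCompactSupport k :=
    HasCompactSupport.intro (isCompact_univ.prod (isCompact_closedBall (0 : Rd d) (R + 1)))
      fun q hq => by
        simp only [k]
        rw [radialCutoff_eq_zero, mul_zero, mul_zero]
        simpa using (not_le.1 (by simpa using hq)).le
  have hkm : (fun q : X × Rd d => k (e q.1, q.2)) ∈ crossGrowth X p d :=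
    mem_crossGrowth_of_bounded (B := ‖v‖ * B) (hk.measurable.comp hE.measurable) fun q => by
      simp only [k]
      rw [abs_mul]
      exact mul_le_mul (v.norm_coe_le_norm _) (hB _) (abs_nonneg _) (norm_nonneg _)
  have hg : Cbp p fun y : Rd d => (1 - radialCutoff d R y) * (K * (1 + ‖y‖ ^ p)) := by
    have h0 : ∀ y : Rd d, 0 ≤ (1 - radialCutoff d R y) * (K * (1 + ‖y‖ ^ p)) := fun y =>
      mul_nonneg (sub_nonneg.2 (radialCutoff_le_one _ _)) (hKw y)
    exact GrowthP.cbp (c := 0) (GrowthP.of_le_of_le (growthP_const 0) ((growthP_weight hp).const_mul K)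
      ((continuous_const.sub (continuous_radialCutoff R)).mul
        (continuous_const.mul (continuous_weight hp))) h0
      (fun y => mul_le_of_le_one_left (hKw y) (by linarith [radialCutoff_nonneg (R : ℝ) y]))) h0
  have hle : ∀ x y, |h.1 (x, y) - k (e x, y)| ≤
      B * |A.indicator (fun _ => (1 : ℝ)) x - v (e x)| +
        (1 - radialCutoff d R y) * (K * (1 + ‖y‖ ^ p)) := by
    intro x y
    have hi1 : |A.indicator (fun _ => (1 : ℝ)) x| ≤ 1 := by
      by_cases hx : x ∈ A <;> simp [hx]
    have : h.1 (x, y) - k (e x, y) =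
        (A.indicator (fun _ => (1 : ℝ)) x - v (e x)) * (ψ y * radialCutoff d R y) +
          A.indicator (fun _ => (1 : ℝ)) x * ((1 - radialCutoff d R y) * ψ y) := by
      rw [hh]
      simp only [k]
      ring
    rw [this]
    refine (abs_add_le _ _).trans (add_le_add ?_ ?_)
    · rw [abs_mul, mul_comm]
      exact mul_le_mul_of_nonneg_right (hB y) (abs_nonneg _)
    · rw [abs_mul, abs_mul, abs_of_nonneg (sub_nonneg.2 (radialCutoff_le_one _ _))]
      exact (mul_le_of_le_one_left (mul_nonneg (sub_nonneg.2 (radialCutoff_le_one _ _))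
        (abs_nonneg _)) hi1).trans
        (mul_le_mul_of_nonneg_left (hK y) (sub_nonneg.2 (radialCutoff_le_one _ _)))
  have hBε : B * (ε / 4 / (B + 1)) ≤ ε / 4 := by
    rw [← mul_div_assoc, div_le_iff₀ (by positivity)]
    nlinarith
  have e₁ := hL.abs_sub_le (h := h) (h' := ⟨_, hkm⟩) (hai.const_mul B) hg hle
  have e₂ := (hπ.hasMarginals hp hν).abs_sub_le (h := h) (h' := ⟨_, hkm⟩) (hai.const_mul B) hg hle
  have e₃ : L ⟨_, hkm⟩ = hπ.integralLinear hp hν ⟨_, hkm⟩ := by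
    rw [hmL k hk hkc ⟨_, hkm⟩ fun _ _ => rfl, ← hπm, hE.integral_map]
    rfl
  rw [integral_const_mul] at e₁ e₂
  have e₄ := mul_le_mul_of_nonneg_left hv' hB0
  change |L h - hπ.integralLinear hp hν h| ≤ ε
  rw [abs_le] at *
  constructor <;> linarith [e₁.1, e₁.2, e₂.1, e₂.2]

end Coupling

section Argmax

/-- The first index at which `s 0, …, s n` attains its maximum. -/
noncomputable def argmaxIndex (s : ℕ → ℝ) : ℕ → ℕ
  | 0 => 0
  | n + 1 => if s (argmaxIndex s n) < s (n + 1) then n + 1 else argmaxIndex s n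

theorem argmaxIndex_le (s : ℕ → ℝ) (n : ℕ) : argmaxIndex s n ≤ n := by
  induction n with
  | zero => exact le_rfl
  | succ n ih => rw [argmaxIndex]; split_ifs <;> omega

theorem monotone_apply_argmaxIndex (s : ℕ → ℝ) : Monotone fun n => s (argmaxIndex s n) := by
  refine monotone_nat_of_le_succ fun n => ?_
  rw [argmaxIndex]
  split_ifs with h
  exacts [h.le, le_rfl]

theorem le_apply_argmaxIndex (s : ℕ → ℝ) (n : ℕ) : s n ≤ s (argmaxIndex s n) := by
  cases n with
  | zero => exact le_rfl
  | succ n =>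
    rw [argmaxIndex]
    split_ifs with h
    exacts [le_rfl, not_lt.1 h]

theorem measurable_apply_nat {X Y : Type*} [MeasurableSpace X] [MeasurableSpace Y] {g : ℕ → X → Y}
    (hg : ∀ k, Measurable (g k)) {κ : X → ℕ} (hκ : Measurable κ) :
    Measurable fun x => g (κ x) x :=
  (measurable_from_prod_countable_right (f := fun q : ℕ × X => g q.1 q.2) hg).comp
    (hκ.prodMk measurable_id)

theorem measurable_argmaxIndex {X : Type*} [MeasurableSpace X] {s : ℕ → X → ℝ}
    (hs : ∀ k, Measurable (s k)) (n : ℕ) : Measurable fun x => argmaxIndex (fun k => s k x) n := by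
  induction n with
  | zero => exact measurable_const
  | succ n ih =>
    simp only [argmaxIndex]
    exact Measurable.ite (measurableSet_lt (measurable_apply_nat hs ih) (hs _)) measurable_const ih

end Argmax

section Disintegration

variable {X : Type*} [MeasurableSpace X] {p : ℝ} {d : ℕ}
  {μ : Measure X} {ν : Measure (Rd d)} {π : Measure (X × Rd d)}

theorem IsCoupling.compProd_disint (hπ : IsCoupling π μ ν) : μ.compProd (disint π) = π := by
  have := hπ.1
  rw [disint, dif_pos (inferInstanceAs (IsFiniteMeasure π)), ← hπ.2.1]
  exact π.disintegrate π.condKernel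

theorem IsCoupling.isMarkovKernel_disint (hπ : IsCoupling π μ ν) :
    ProbabilityTheory.IsMarkovKernel (disint π) := by
  have := hπ.1
  rw [disint, dif_pos (inferInstanceAs (IsFiniteMeasure π))]
  infer_instance

theorem IsCoupling.isProbabilityMeasure_left (hπ : IsCoupling π μ ν) : IsProbabilityMeasure μ := by
  have := hπ.1
  rw [← hπ.2.1]
  exact Measure.isProbabilityMeasure_map measurable_fst.aemeasurable

theorem IsCoupling.integrable_integral_disint (hπ : IsCoupling π μ ν) {h : X × Rd d → ℝ}
    (hh : Integrable h π) : Integrable (fun x => ∫ y, h (x, y) ∂(disint π x)) μ := by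
  have := hπ.isMarkovKernel_disint
  have := hπ.isProbabilityMeasure_left
  rw [← hπ.compProd_disint] at hh
  have h1 := ((Measure.integrable_compProd_iff hh.1).1 hh).2
  exact h1.mono' hh.1.integral_kernel_compProd (Eventually.of_forall fun x =>
    norm_integral_le_integral_norm _)

theorem IsCoupling.integral_integral_disint (hπ : IsCoupling π μ ν) {h : X × Rd d → ℝ}
    (hh : Integrable h π) : ∫ x, ∫ y, h (x, y) ∂(disint π x) ∂μ = ∫ q, h q ∂π := by
  have := hπ.isMarkovKernel_disint
  have := hπ.isProbabilityMeasure_left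
  conv_rhs => rw [← hπ.compProd_disint]
  rw [← hπ.compProd_disint] at hh
  exact (Measure.integral_compProd hh).symm

theorem IsCoupling.measurable_integral_disint (hπ : IsCoupling π μ ν) {ψ : Rd d → ℝ}
    (hψ : Continuous ψ) : Measurable fun x => ∫ y, ψ y ∂(disint π x) := by
  have := hπ.isMarkovKernel_disint
  exact ((hψ.stronglyMeasurable.comp_measurable measurable_snd).integral_kernel_prod_right'
      (κ := disint π)).measurable

theorem IsCoupling.ae_hasMomentP (hπ : IsCoupling π μ ν) (hν : HasMomentP p ν) :
    ∀ᵐ x ∂μ, IsProbabilityMeasure (disint π x) ∧ HasMomentP p (disint π x) := by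
  have := hπ.isMarkovKernel_disint
  have := hπ.isProbabilityMeasure_left
  have hm : Measurable fun y : Rd d => ENNReal.ofReal (‖y‖ ^ p) := by fun_prop
  have h1 : ∫⁻ x, ∫⁻ y, ENNReal.ofReal (‖y‖ ^ p) ∂(disint π x) ∂μ ≠ ⊤ := by
    rw [← Measure.lintegral_compProd (f := fun q : X × Rd d => ENNReal.ofReal (‖q.2‖ ^ p))
      (hm.comp measurable_snd), hπ.compProd_disint]
    rw [HasMomentP, ← hπ.2.2, lintegral_map hm measurable_snd] at hν
    exact hν
  filter_upwards [ae_lt_top (hm.lintegral_kernel) h1] with x hx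
  exact ⟨inferInstance, hx.ne⟩

theorem exists_coupling_lintegral_le [StandardBorelSpace X] (hp : 0 ≤ p)
    [IsProbabilityMeasure μ] [IsProbabilityMeasure ν] (hν : HasMomentP p ν)
    {c : X → Pp p d → ℝ≥0∞} {ψ : ℕ → Rd d → ℝ} {f : ℕ → X → ℝ} (hψ : ∀ k, Cbp p (ψ k))
    (hf : ∀ k, Measurable (f k)) (hfb : ∀ k, ∃ B, ∀ x, |f k x| ≤ B)
    (hψ0 : ∀ y, ψ 0 y = 0) (hf0 : ∀ x, f 0 x = 0)
    (hc : ∀ᵐ x ∂μ, ∀ (ρ : Pp p d) (k : ℕ), ENNReal.ofReal (f k x - ∫ y, ψ k y ∂ρ.1) ≤ c x ρ)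
    {D : ℝ} (H : ∀ φ : Rd d → ℝ, Cbp p φ → ∀ F : X → ℝ, Integrable F μ →
      (∀ᵐ x ∂μ, ∀ ρ : Pp p d, ENNReal.ofReal (F x - ∫ y, φ y ∂ρ.1) ≤ c x ρ) →
      ∫ x, F x ∂μ ≤ D + ∫ y, φ y ∂ν) :
    ∃ π : Measure (X × Rd d), IsCoupling π μ ν ∧
      ∫⁻ x, ⨆ k, ENNReal.ofReal (f k x - ∫ y, ψ k y ∂(disint π x)) ∂μ ≤ ENNReal.ofReal D := by
  obtain ⟨L, hL, hLc⟩ := exists_linear_functional hp hν H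
  obtain ⟨π, hπ, hLπ⟩ := exists_coupling_of_hasMarginals hp hν (L := L) hL
  refine ⟨π, hπ, ?_⟩
  let s : ℕ → X → ℝ := fun k x => f k x - ∫ y, ψ k y ∂(disint π x)
  have hs : ∀ k, Measurable (s k) := fun k =>
    (hf k).sub (hπ.measurable_integral_disint (hψ k).1)
  let κ : ℕ → X → ℕ := fun n x => argmaxIndex (fun k => s k x) n
  have hκ : ∀ n, Measurable (κ n) := measurable_argmaxIndex hs
  have hcross : ∀ (A : Set X) (k : ℕ), MeasurableSet A →
      (fun q : X × Rd d => A.indicator (fun _ => (1 : ℝ)) q.1 * ψ k q.2) ∈ crossGrowth X p d := by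
    intro A k hA
    obtain ⟨K, hK⟩ := ((hψ k).growthP hp).2
    refine ⟨((measurable_const.indicator hA).comp measurable_fst).mul
      ((hψ k).1.measurable.comp measurable_snd), K, fun x y => ?_⟩
    rw [abs_mul]
    refine (mul_le_of_le_one_left (abs_nonneg _) ?_).trans (hK y)
    by_cases hx : x ∈ A <;> simp [hx]
  have hκm : ∀ n k, MeasurableSet {x | κ n x = k} := fun n k => hκ n (measurableSet_singleton k)
  have hbound : ∀ n, ∫⁻ x, ENNReal.ofReal (s (κ n x) x) ∂μ ≤ ENNReal.ofReal D := by
    intro n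
    let Ψ : crossGrowth X p d := ∑ k ∈ Finset.range (n + 1), ⟨_, hcross _ k (hκm n k)⟩
    have hΨ : ∀ x y, Ψ.1 (x, y) = ψ (κ n x) y := fun x y => by
      simp only [Ψ, AddSubmonoidClass.coe_finsetSum, Finset.sum_apply]
      rw [Finset.sum_eq_single (κ n x)]
      · simp
      · intro k _ hk
        rw [indicator_of_notMem (fun h' => hk h'.symm), zero_mul]
      · intro h'
        exact absurd (Finset.mem_range.2 (Nat.lt_succ_of_le (argmaxIndex_le _ n))) h'
    have hLΨ : L Ψ = ∫ q, Ψ.1 q ∂π := by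
      change L Ψ = hπ.integralLinear hp hν Ψ
      rw [map_sum, map_sum]
      exact Finset.sum_congr rfl fun k _ =>
        hLπ _ _ (hκm n k) ((hψ k).growthP hp) _ fun _ _ => rfl
    have hFm : Measurable fun x => f (κ n x) x := measurable_apply_nat hf (hκ n)
    have hFi : Integrable (fun x => f (κ n x) x) μ := by
      choose B hB using hfb
      refine (integrable_const (∑ k ∈ Finset.range (n + 1), B k)).mono' hFm.aestronglyMeasurable
        (Eventually.of_forall fun x => (hB _ x).trans ?_)
      exact Finset.single_le_sum (f := B) (fun k _ => (abs_nonneg _).trans (hB k x))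
        (Finset.mem_range.2 (Nat.lt_succ_of_le (argmaxIndex_le _ n)))
    have hΨi := hπ.integrable_crossGrowth hp hν Ψ.2
    have h1 := hLc Ψ _ hFi (by
      filter_upwards [hc] with x hx ρ
      simpa only [hΨ] using hx ρ (κ n x))
    rw [hLΨ, ← hπ.integral_integral_disint hΨi] at h1
    have h2 := hπ.integrable_integral_disint hΨi
    simp only [hΨ] at h1 h2
    have hsi : Integrable (fun x => s (κ n x) x) μ := hFi.sub h2
    rw [← ofReal_integral_eq_lintegral_ofReal hsi]
    · refine ENNReal.ofReal_le_ofReal ?_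
      simp only [s]
      rw [integral_sub hFi h2]
      linarith
    · refine Eventually.of_forall fun x => ?_
      have := monotone_apply_argmaxIndex (fun k => s k x) (Nat.zero_le n)
      refine le_trans (le_of_eq ?_) this
      simp [argmaxIndex, s, hψ0, hf0]
  have heq : ∀ x, ⨆ k, ENNReal.ofReal (s k x) = ⨆ n, ENNReal.ofReal (s (κ n x) x) := fun x =>
    le_antisymm (iSup_mono fun n => ENNReal.ofReal_le_ofReal (le_apply_argmaxIndex (fun k => s k x) n))
      (iSup_le fun n => le_iSup (fun k => ENNReal.ofReal (s k x)) (κ n x))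
  change ∫⁻ x, ⨆ k, ENNReal.ofReal (s k x) ∂μ ≤ _
  simp only [heq]
  rw [lintegral_iSup (fun n => (measurable_apply_nat hs (hκ n)).ennreal_ofReal)
    fun n m hnm x => ENNReal.ofReal_le_ofReal (monotone_apply_argmaxIndex (fun k => s k x) hnm)]
  exact iSup_le hbound

end Disintegration

section ExtendedIntegral

variable {α : Type*} [MeasurableSpace α] {μ : Measure α}

theorem erealToENN_mono {x y : EReal} (h : x ≤ y) : erealToENN x ≤ erealToENN y := by
  unfold erealToENN
  split_ifs with hx hy hy
  · exact le_rfl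
  · exact absurd (top_le_iff.1 (hx ▸ h)) hy
  · exact le_top
  · by_cases hb : x = ⊥
    · simp [hb]
    · exact ENNReal.ofReal_le_ofReal (EReal.toReal_le_toReal h hb hy)

theorem eInt_mono_ae {f g : α → EReal} (h : ∀ᵐ x ∂μ, f x ≤ g x) : eInt μ f ≤ eInt μ g := by
  refine EReal.sub_le_sub ?_ ?_ <;> rw [EReal.coe_ennreal_le_coe_ennreal_iff]
  · exact lintegral_mono_ae (h.mono fun x hx => erealToENN_mono hx)
  · exact lintegral_mono_ae (h.mono fun x hx => erealToENN_mono (EReal.neg_le_neg_iff.2 hx))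

theorem eInt_congr_ae {f g : α → EReal} (h : ∀ᵐ x ∂μ, f x = g x) : eInt μ f = eInt μ g :=
  le_antisymm (eInt_mono_ae (h.mono fun _ hx => hx.le)) (eInt_mono_ae (h.mono fun _ hx => hx.ge))

theorem erealToENN_coe_add_coe (g : ℝ≥0∞) (k : ℝ) :
    erealToENN ((g : EReal) + (k : EReal)) = g + ENNReal.ofReal k - ENNReal.ofReal (-k) := by
  induction g using ENNReal.recTopCoe with
  | top =>
    rw [EReal.coe_ennreal_top, EReal.top_add_coe, top_add, ENNReal.top_sub ENNReal.ofReal_ne_top]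
    simp [erealToENN]
  | coe g =>
    have : ((g : ℝ≥0∞) : EReal) + (k : EReal) = (((g : ℝ) + k : ℝ) : EReal) := by
      rw [EReal.coe_add]; rfl
    rw [this, erealToENN_coe, ← ENNReal.ofReal_coe_nnreal]
    rcases le_total 0 k with hk | hk
    · rw [ENNReal.ofReal_of_nonpos (neg_nonpos.2 hk), tsub_zero, ENNReal.ofReal_add g.coe_nonneg hk]
    · rw [ENNReal.ofReal_of_nonpos hk, add_zero, ← ENNReal.ofReal_sub _ (neg_nonneg.2 hk),
        sub_neg_eq_add]

theorem erealToENN_neg_coe_add_coe (g : ℝ≥0∞) (k : ℝ) :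
    erealToENN (-((g : EReal) + (k : EReal))) =
      ENNReal.ofReal (-k) - (g + ENNReal.ofReal k) := by
  induction g using ENNReal.recTopCoe with
  | top =>
    rw [EReal.coe_ennreal_top, EReal.top_add_coe, top_add]
    simp [erealToENN]
  | coe g =>
    have : -(((g : ℝ≥0∞) : EReal) + (k : EReal)) = ((-((g : ℝ) + k) : ℝ) : EReal) := by
      rw [EReal.coe_neg, EReal.coe_add]; rfl
    rw [this, erealToENN_coe, ← ENNReal.ofReal_coe_nnreal]
    rcases le_total 0 k with hk | hk
    · rw [ENNReal.ofReal_of_nonpos (neg_nonpos.2 hk), zero_tsub, ENNReal.ofReal_of_nonpos]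
      have : (0 : ℝ) ≤ g := g.coe_nonneg
      linarith
    · rw [ENNReal.ofReal_of_nonpos hk, add_zero, ← ENNReal.ofReal_sub _ g.coe_nonneg]
      congr 1
      ring

theorem eInt_coe_add_coe {g : α → ℝ≥0∞} (hg : AEMeasurable g μ) {k : α → ℝ} (hk : Integrable k μ) :
    eInt μ (fun x => (g x : EReal) + (k x : EReal)) =
      ((∫⁻ x, g x ∂μ : ℝ≥0∞) : EReal) + ((∫ x, k x ∂μ : ℝ) : EReal) := by
  have hk₁ : AEMeasurable (fun x => ENNReal.ofReal (k x)) μ := hk.1.aemeasurable.ennreal_ofReal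
  have hk₂ : AEMeasurable (fun x => ENNReal.ofReal (-k x)) μ := hk.1.aemeasurable.neg.ennreal_ofReal
  have hp : ∫⁻ x, ENNReal.ofReal (k x) ∂μ ≠ ∞ := hk.lintegral_lt_top.ne
  have hn : ∫⁻ x, ENNReal.ofReal (-k x) ∂μ ≠ ∞ := hk.neg.lintegral_lt_top.ne
  have hN : ∫⁻ x, (ENNReal.ofReal (-k x) - (g x + ENNReal.ofReal (k x))) ∂μ ≠ ∞ :=
    ne_top_of_le_ne_top hn (lintegral_mono fun x => tsub_le_self)
  have key : ∫⁻ x, (g x + ENNReal.ofReal (k x) - ENNReal.ofReal (-k x)) ∂μ +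
      ∫⁻ x, ENNReal.ofReal (-k x) ∂μ =
        ∫⁻ x, g x ∂μ + ∫⁻ x, ENNReal.ofReal (k x) ∂μ +
          ∫⁻ x, (ENNReal.ofReal (-k x) - (g x + ENNReal.ofReal (k x))) ∂μ := by
    have hgk : AEMeasurable (fun x => g x + ENNReal.ofReal (k x)) μ := hg.add hk₁
    rw [← lintegral_add_right' _ hk₂, ← lintegral_add_right' _ hk₁, ← lintegral_add_left' hgk]
    refine lintegral_congr fun x => ?_
    rw [tsub_add_eq_max, add_tsub_eq_max]
  simp only [eInt, erealToENN_coe_add_coe, erealToENN_neg_coe_add_coe]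
  rw [integral_eq_lintegral_pos_part_sub_lintegral_neg_part hk, EReal.coe_sub,
    EReal.coe_ennreal_toReal hp, EReal.coe_ennreal_toReal hn]
  generalize ∫⁻ x, (g x + ENNReal.ofReal (k x) - ENNReal.ofReal (-k x)) ∂μ = P at *
  generalize ∫⁻ x, (ENNReal.ofReal (-k x) - (g x + ENNReal.ofReal (k x))) ∂μ = N at *
  generalize ∫⁻ x, ENNReal.ofReal (k x) ∂μ = A at *
  generalize ∫⁻ x, ENNReal.ofReal (-k x) ∂μ = B at *
  generalize ∫⁻ x, g x ∂μ = G at *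
  lift N to NNReal using hN
  lift A to NNReal using hp
  lift B to NNReal using hn
  have hAB : ((A : ℝ≥0∞) : EReal) - ((B : ℝ≥0∞) : EReal) = (((A : ℝ) - B : ℝ) : EReal) := by
    rw [EReal.coe_sub]; rfl
  rw [hAB]
  induction G using ENNReal.recTopCoe with
  | top =>
    rw [top_add, top_add, ENNReal.add_eq_top] at key
    rw [key.resolve_right ENNReal.coe_ne_top, EReal.coe_ennreal_top, EReal.top_add_coe]
    exact EReal.top_sub_coe N
  | coe G =>
    have hP : P ≠ ∞ := by
      rintro rfl
      rw [top_add] at key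
      exact ENNReal.coe_ne_top (by exact_mod_cast key.symm)
    lift P to NNReal using hP
    have key' : (P : ℝ) + B = G + A + N := by exact_mod_cast key
    change ((P : ℝ) : EReal) - ((N : ℝ) : EReal) = ((G : ℝ) : EReal) + _
    rw [← EReal.coe_sub, ← EReal.coe_add, EReal.coe_eq_coe_iff]
    linarith

end ExtendedIntegral

section ShiftedCost

variable {X : Type*} {p : ℝ} {d : ℕ} {C : X → Measure (Rd d) → EReal} {a : X → ℝ} {b : Rd d → ℝ}

/-- The cost `C` shifted by its integrable lower bound, as a nonnegative cost. -/
noncomputable def shiftedCost (C : X → Measure (Rd d) → EReal) (a : X → ℝ) (b : Rd d → ℝ)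
    (x : X) (ρ : Pp p d) : ℝ≥0∞ :=
  (C x ρ.1 + ((a x + ∫ y, b y ∂ρ.1 : ℝ) : EReal)).toENNReal

theorem coe_shiftedCost
    (hlb : ∀ x : X, ∀ ρ : Pp p d, ((-(a x + ∫ y, b y ∂ρ.1) : ℝ) : EReal) ≤ C x ρ.1)
    (x : X) (ρ : Pp p d) :
    ((shiftedCost C a b x ρ : ℝ≥0∞) : EReal) = C x ρ.1 + ((a x + ∫ y, b y ∂ρ.1 : ℝ) : EReal) := by
  refine EReal.coe_toENNReal ?_
  calc (0 : EReal) = ((-(a x + ∫ y, b y ∂ρ.1) : ℝ) : EReal) +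
        ((a x + ∫ y, b y ∂ρ.1 : ℝ) : EReal) := by
        rw [← EReal.coe_add, neg_add_cancel, EReal.coe_zero]
    _ ≤ _ := add_le_add_left (hlb x ρ) _

theorem eq_shiftedCost_add
    (hlb : ∀ x : X, ∀ ρ : Pp p d, ((-(a x + ∫ y, b y ∂ρ.1) : ℝ) : EReal) ≤ C x ρ.1)
    (x : X) (ρ : Pp p d) :
    C x ρ.1 = ((shiftedCost C a b x ρ : ℝ≥0∞) : EReal) +
      ((-(a x + ∫ y, b y ∂ρ.1) : ℝ) : EReal) := by
  rw [coe_shiftedCost hlb, EReal.coe_neg, ← sub_eq_add_neg, EReal.add_sub_cancel_right]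

theorem lowerSemicontinuous_shiftedCost [TopologicalSpace X]
    (hlsc : LowerSemicontinuous fun q : X × Pp p d => C q.1 q.2.1)
    (ha : LowerSemicontinuous a) (hb : GrowthP p b) :
    LowerSemicontinuous fun q : X × Pp p d => shiftedCost C a b q.1 q.2 := by
  have h₁ : LowerSemicontinuous fun q : X × Pp p d => a q.1 + ∫ y, b y ∂q.2.1 :=
    (ha.comp continuous_fst).add (hb.continuous_integral.comp continuous_snd).lowerSemicontinuous
  have h₂ : LowerSemicontinuous fun q : X × Pp p d =>
      ((a q.1 + ∫ y, b y ∂q.2.1 : ℝ) : EReal) :=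
    continuous_coe_real_ereal.comp_lowerSemicontinuous h₁ EReal.coe_strictMono.monotone
  refine EReal.continuous_toENNReal.comp_lowerSemicontinuous (hlsc.add' h₂ fun q => ?_)
    fun _ _ h => EReal.toENNReal_le_toENNReal h
  exact EReal.continuousAt_add (Or.inr (EReal.coe_ne_bot _)) (Or.inr (EReal.coe_ne_top _))

theorem shiftedCost_mix_le (hp : 0 ≤ p) (hb : GrowthP p b)
    (hconv : ∀ x : X, ∀ ρ₁ ρ₂ : Pp p d, ∀ t : ℝ, 0 ≤ t → t ≤ 1 →
      C x ((ENNReal.ofReal t) • ρ₁.1 + (ENNReal.ofReal (1 - t)) • ρ₂.1)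
        ≤ (t : EReal) * C x ρ₁.1 + ((1 - t : ℝ) : EReal) * C x ρ₂.1)
    (hlb : ∀ x : X, ∀ ρ : Pp p d, ((-(a x + ∫ y, b y ∂ρ.1) : ℝ) : EReal) ≤ C x ρ.1)
    (x : X) (ρ₁ ρ₂ : Pp p d) (t : ℝ) (h0 : 0 ≤ t) (h1 : t ≤ 1) :
    shiftedCost C a b x ⟨_, Pp.mix_mem ρ₁ ρ₂ h0 h1⟩ ≤
      ENNReal.ofReal t * shiftedCost C a b x ρ₁ +
        ENNReal.ofReal (1 - t) * shiftedCost C a b x ρ₂ := by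
  have h1' : 0 ≤ 1 - t := sub_nonneg.2 h1
  rw [← EReal.coe_ennreal_le_coe_ennreal_iff, EReal.coe_ennreal_add, EReal.coe_ennreal_mul,
    EReal.coe_ennreal_mul, EReal.coe_ennreal_ofReal, EReal.coe_ennreal_ofReal, max_eq_left h0,
    max_eq_left h1', coe_shiftedCost hlb, coe_shiftedCost hlb, coe_shiftedCost hlb,
    EReal.left_distrib_of_nonneg_of_ne_top (EReal.coe_nonneg.2 h0) (EReal.coe_ne_top _),
    EReal.left_distrib_of_nonneg_of_ne_top (EReal.coe_nonneg.2 h1') (EReal.coe_ne_top _),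
    add_add_add_comm]
  refine add_le_add (hconv x ρ₁ ρ₂ t h0 h1) (le_of_eq ?_)
  rw [← EReal.coe_mul, ← EReal.coe_mul, ← EReal.coe_add, EReal.coe_eq_coe_iff]
  dsimp only
  rw [Pp.integral_mix h0 h1 (hb.integrable_pp hp ρ₁) (hb.integrable_pp hp ρ₂)]
  ring

end ShiftedCost

section SignedDuality

variable {X : Type*} [MeasurableSpace X] {p : ℝ} {d : ℕ} {μ : Measure X} {ν : Measure (Rd d)}
  {C : X → Measure (Rd d) → EReal} {a : X → ℝ} {b : Rd d → ℝ} {ψ : ℕ → Rd d → ℝ} {f : ℕ → X → ℝ}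
  {π : Measure (X × Rd d)}

theorem IsCoupling.integrable_disint_snd (hπ : IsCoupling π μ ν) {g : Rd d → ℝ}
    (hg : Integrable g ν) : Integrable (fun x => ∫ y, g y ∂(disint π x)) μ :=
  hπ.integrable_integral_disint (h := fun q => g q.2) (hπ.integrable_snd hg)

theorem IsCoupling.integral_disint_snd (hπ : IsCoupling π μ ν) {g : Rd d → ℝ}
    (hg : Integrable g ν) : ∫ x, ∫ y, g y ∂(disint π x) ∂μ = ∫ y, g y ∂ν :=
  (hπ.integral_integral_disint (h := fun q => g q.2) (hπ.integrable_snd hg)).trans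
    (hπ.integral_snd hg)

theorem IsCoupling.measurable_iSup_disint (hπ : IsCoupling π μ ν) (hψ : ∀ k, Cbp p (ψ k))
    (hf : ∀ k, Measurable (f k)) :
    Measurable fun x => ⨆ k, ENNReal.ofReal (f k x - ∫ y, ψ k y ∂(disint π x)) :=
  Measurable.iSup fun k => ((hf k).sub (hπ.measurable_integral_disint (hψ k).1)).ennreal_ofReal

theorem IsCoupling.ae_cost_eq (hπ : IsCoupling π μ ν) (hν : HasMomentP p ν)
    (hlb : ∀ x : X, ∀ ρ : Pp p d, ((-(a x + ∫ y, b y ∂ρ.1) : ℝ) : EReal) ≤ C x ρ.1)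
    (hrep : ∀ᵐ x ∂μ, ∀ ρ : Pp p d,
      shiftedCost C a b x ρ = ⨆ k, ENNReal.ofReal (f k x - ∫ y, ψ k y ∂ρ.1)) :
    ∀ᵐ x ∂μ, C x (disint π x) =
      ((⨆ k, ENNReal.ofReal (f k x - ∫ y, ψ k y ∂(disint π x)) : ℝ≥0∞) : EReal) +
        ((-(a x + ∫ y, b y ∂(disint π x)) : ℝ) : EReal) := by
  filter_upwards [hrep, hπ.ae_hasMomentP hν] with x hx hm
  have := eq_shiftedCost_add hlb x ⟨disint π x, hm⟩
  rwa [hx] at this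

theorem bot_lt_eInt_eConj_sub (ha : Integrable a μ)
    (hlb : ∀ x : X, ∀ ρ : Pp p d, ((-(a x + ∫ y, b y ∂ρ.1) : ℝ) : EReal) ≤ C x ρ.1) :
    ⊥ < eInt μ (eConj p C b) - ((∫ y, b y ∂ν : ℝ) : EReal) := by
  have h : ∀ x, ((-a x : ℝ) : EReal) ≤ eConj p C b x := fun x => le_iInf fun ρ => by
    calc ((-a x : ℝ) : EReal) = ((∫ y, b y ∂ρ.1 : ℝ) : EReal) +
          ((-(a x + ∫ y, b y ∂ρ.1) : ℝ) : EReal) := by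
          rw [← EReal.coe_add]
          congr 1
          ring
      _ ≤ _ := add_le_add_right (hlb x ρ) _
  have h₁ := (eInt_eq_integral (f := fun x => -a x) ha.neg).symm.trans_le
    (eInt_mono_ae (Eventually.of_forall h))
  refine lt_of_lt_of_le ?_ (EReal.sub_le_sub h₁ le_rfl)
  rw [← EReal.coe_sub]
  exact EReal.bot_lt_coe _

variable [IsProbabilityMeasure ν]

theorem IsCoupling.eInt_cost_eq (hp : 0 ≤ p) (hπ : IsCoupling π μ ν) (hν : HasMomentP p ν)
    (ha : Integrable a μ) (hb : GrowthP p b)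
    (hψ : ∀ k, Cbp p (ψ k)) (hf : ∀ k, Measurable (f k))
    (hlb : ∀ x : X, ∀ ρ : Pp p d, ((-(a x + ∫ y, b y ∂ρ.1) : ℝ) : EReal) ≤ C x ρ.1)
    (hrep : ∀ᵐ x ∂μ, ∀ ρ : Pp p d,
      shiftedCost C a b x ρ = ⨆ k, ENNReal.ofReal (f k x - ∫ y, ψ k y ∂ρ.1)) :
    eInt μ (fun x => C x (disint π x)) =
      ((∫⁻ x, ⨆ k, ENNReal.ofReal (f k x - ∫ y, ψ k y ∂(disint π x)) ∂μ : ℝ≥0∞) : EReal) +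
        ((-(∫ x, a x ∂μ + ∫ y, b y ∂ν) : ℝ) : EReal) := by
  have hbν : Integrable b ν := hb.integrable hp hν
  have hi : Integrable (fun x => ∫ y, b y ∂(disint π x)) μ := hπ.integrable_disint_snd hbν
  rw [eInt_congr_ae (hπ.ae_cost_eq hν hlb hrep),
    eInt_coe_add_coe (hπ.measurable_iSup_disint hψ hf).aemeasurable
      (k := fun x => -(a x + ∫ y, b y ∂(disint π x))) (ha.add hi).neg,
    integral_neg, integral_add ha hi, hπ.integral_disint_snd hbν]

theorem IsCoupling.eInt_eConj_sub_le (hp : 0 ≤ p) (hπ : IsCoupling π μ ν) (hν : HasMomentP p ν)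
    (ha : Integrable a μ) (hb : GrowthP p b)
    (hψ : ∀ k, Cbp p (ψ k)) (hf : ∀ k, Measurable (f k))
    (hlb : ∀ x : X, ∀ ρ : Pp p d, ((-(a x + ∫ y, b y ∂ρ.1) : ℝ) : EReal) ≤ C x ρ.1)
    (hrep : ∀ᵐ x ∂μ, ∀ ρ : Pp p d,
      shiftedCost C a b x ρ = ⨆ k, ENNReal.ofReal (f k x - ∫ y, ψ k y ∂ρ.1))
    {g : Rd d → ℝ} (hg : GrowthP p g) :
    eInt μ (eConj p C g) - ((∫ y, g y ∂ν : ℝ) : EReal) ≤ eInt μ (fun x => C x (disint π x)) := by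
  have hbν : Integrable b ν := hb.integrable hp hν
  have hgν : Integrable g ν := hg.integrable hp hν
  have hi : Integrable (fun x => ∫ y, b y ∂(disint π x)) μ := hπ.integrable_disint_snd hbν
  have hj : Integrable (fun x => ∫ y, g y ∂(disint π x)) μ := hπ.integrable_disint_snd hgν
  have hai : Integrable (fun x => -(a x + ∫ y, b y ∂(disint π x))) μ := (ha.add hi).neg
  have hle : ∀ᵐ x ∂μ, eConj p C g x ≤
      ((⨆ k, ENNReal.ofReal (f k x - ∫ y, ψ k y ∂(disint π x)) : ℝ≥0∞) : EReal) +
        ((-(a x + ∫ y, b y ∂(disint π x)) + ∫ y, g y ∂(disint π x) : ℝ) : EReal) := by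
    filter_upwards [hπ.ae_cost_eq hν hlb hrep, hπ.ae_hasMomentP hν] with x hx hm
    refine (iInf_le _ (⟨disint π x, hm⟩ : Pp p d)).trans_eq ?_
    dsimp only
    rw [hx, EReal.coe_add, add_comm, add_assoc]
  refine EReal.sub_le_of_le_add ((eInt_mono_ae hle).trans_eq ?_)
  rw [hπ.eInt_cost_eq hp hν ha hb hψ hf hlb hrep,
    eInt_coe_add_coe (hπ.measurable_iSup_disint hψ hf).aemeasurable
      (k := fun x => -(a x + ∫ y, b y ∂(disint π x)) + ∫ y, g y ∂(disint π x)) (hai.add hj),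
    integral_add hai hj, integral_neg, integral_add ha hi, hπ.integral_disint_snd hbν,
    hπ.integral_disint_snd hgν, EReal.coe_add, add_assoc]

theorem integral_le_of_forall_dual_le [IsProbabilityMeasure μ] (hp : 1 ≤ p) (hν : HasMomentP p ν)
    (ha : Integrable a μ) (hb : Cbp p b) (hbc : ConvexOn ℝ univ b)
    (hlb : ∀ x : X, ∀ ρ : Pp p d, ((-(a x + ∫ y, b y ∂ρ.1) : ℝ) : EReal) ≤ C x ρ.1)
    (hmono : ∀ x : X, ∀ ρ₁ ρ₂ : Pp p d, ConvexOrder ρ₁.1 ρ₂.1 → C x ρ₂.1 ≤ C x ρ₁.1)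
    {s : ℝ} (hs : ∀ φ : Rd d → ℝ, Cbp p φ → ConvexOn ℝ univ (fun y => φ y + b y) →
      eInt μ (eConj p C fun y => φ y + b y) - ((∫ y, (φ y + b y) ∂ν : ℝ) : EReal) ≤ s)
    {φ : Rd d → ℝ} (hφ : Cbp p φ) {F : X → ℝ} (hF : Integrable F μ)
    (hle : ∀ᵐ x ∂μ, ∀ ρ : Pp p d,
      ENNReal.ofReal (F x - ∫ y, φ y ∂ρ.1) ≤ shiftedCost C a b x ρ) :
    ∫ x, F x ∂μ ≤ s + ∫ x, a x ∂μ + ∫ y, b y ∂ν + ∫ y, φ y ∂ν := by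
  have hp0 : 0 ≤ p := by linarith
  have hbg := hb.growthP hp0
  have hφg := hφ.growthP hp0
  obtain ⟨m, hm⟩ := hφ.2.1
  obtain ⟨g, hgc, hg, hbg', hgφ, hgC⟩ := exists_convex_potential hp (ψ := fun y => φ y + b y)
    (b := fun y => m + b y) (hφg.add hbg) ((growthP_const m).add hbg)
    ((convexOn_const m convex_univ).add hbc) fun y => by linarith [hm y]
  have hφ' : Cbp p fun y => g y + -1 * b y :=
    (hg.add (hbg.const_mul (-1))).cbp (c := m) fun y => by linarith [hbg' y]
  have hgeq : (fun y => g y + -1 * b y + b y) = g := by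
    ext y
    ring
  have hsg := hs _ hφ' (by rw [hgeq]; exact hgc)
  rw [hgeq] at hsg
  have hconj : ∀ᵐ x ∂μ, ((F x - a x : ℝ) : EReal) ≤ eConj p C g x := by
    filter_upwards [hle] with x hx
    refine le_iInf (hgC (fun ρ => C x ρ.1) (hmono x) _ fun ρ => ?_)
    have h := EReal.coe_ennreal_le_coe_ennreal_iff.2 (hx ρ)
    rw [EReal.coe_ennreal_ofReal] at h
    have h' : ((F x - ∫ y, φ y ∂ρ.1 : ℝ) : EReal) ≤ shiftedCost C a b x ρ :=
      (EReal.coe_le_coe_iff.2 (le_max_left _ _)).trans h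
    rw [integral_add (hφg.integrable_pp hp0 ρ) (hbg.integrable_pp hp0 ρ),
      eq_shiftedCost_add hlb x ρ]
    calc ((F x - a x : ℝ) : EReal)
        = ((∫ y, φ y ∂ρ.1 + ∫ y, b y ∂ρ.1 : ℝ) : EReal) + (((F x - ∫ y, φ y ∂ρ.1 : ℝ) : EReal) +
            ((-(a x + ∫ y, b y ∂ρ.1) : ℝ) : EReal)) := by
          rw [← EReal.coe_add, ← EReal.coe_add]
          congr 1
          ring
      _ ≤ _ := add_le_add_right (add_le_add_left h' _) _
  have hFa : Integrable (fun x => F x - a x) μ := hF.sub ha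
  have h₁ := (eInt_eq_integral hFa).symm.trans_le (eInt_mono_ae hconj)
  have h₂ := (EReal.sub_le_sub h₁ le_rfl).trans hsg
  rw [← EReal.coe_sub, EReal.coe_le_coe_iff, integral_sub hF ha] at h₂
  have h₃ : ∫ y, g y ∂ν ≤ ∫ y, φ y ∂ν + ∫ y, b y ∂ν := by
    rw [← integral_add (hφg.integrable hp0 hν) (hbg.integrable hp0 hν)]
    exact integral_mono (hg.integrable hp0 hν)
      ((hφg.integrable hp0 hν).add (hbg.integrable hp0 hν)) hgφ
  linarith

end SignedDuality

/-- **Duality with convex potentials for costs that may take negative values**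
(Theorem 6): if `C : X × P_p(ℝ^d) → (-∞,∞]` is lsc, convex and `≼_c`-decreasing in its
second argument and bounded below by `-(a_ℓ(x) + ρ(b_ℓ))` with `a_ℓ ∈ L¹(μ)` lsc and
`b_ℓ ∈ C_{b,p}` convex, then duality holds with convex potentials of the form
`φ + b_ℓ`, `φ ∈ C_{b,p}`. -/
theorem weak_transport_duality_signed_cost
    {X : Type*} [TopologicalSpace X] [PolishSpace X] [MeasurableSpace X] [BorelSpace X]
    {d : ℕ} {p : ℝ} (hp : 1 ≤ p)
    (μ : Measure X) (hμ : IsProbabilityMeasure μ)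
    (ν : Measure (Rd d)) (hν : IsProbabilityMeasure ν) (hνp : HasMomentP p ν)
    (C : X → Measure (Rd d) → EReal)
    (hbot : ∀ x : X, ∀ ρ : Pp p d, C x ρ.1 ≠ ⊥)
    (hlsc : LowerSemicontinuous fun q : X × Pp p d => C q.1 q.2.1)
    (hconv : ∀ x : X, ∀ ρ₁ ρ₂ : Pp p d, ∀ t : ℝ, 0 ≤ t → t ≤ 1 →
      C x ((ENNReal.ofReal t) • ρ₁.1 + (ENNReal.ofReal (1 - t)) • ρ₂.1)
        ≤ (t : EReal) * C x ρ₁.1 + ((1 - t : ℝ) : EReal) * C x ρ₂.1)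
    (aℓ : X → ℝ) (haℓ_lsc : LowerSemicontinuous aℓ) (haℓ_int : Integrable aℓ μ)
    (bℓ : Rd d → ℝ) (hbℓ : Cbp p bℓ) (hbℓ_conv : ConvexOn ℝ Set.univ bℓ)
    (hlb : ∀ x : X, ∀ ρ : Pp p d,
      ((-(aℓ x + ∫ y, bℓ y ∂ρ.1) : ℝ) : EReal) ≤ C x ρ.1)
    (hmono : ∀ x : X, ∀ ρ₁ ρ₂ : Pp p d, ConvexOrder ρ₁.1 ρ₂.1 → C x ρ₂.1 ≤ C x ρ₁.1) :
    eprimal μ ν C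
      = ⨆ ψ : {ψ : Rd d → ℝ // (∃ φ : Rd d → ℝ, Cbp p φ ∧ ψ = fun y => φ y + bℓ y) ∧
            ConvexOn ℝ Set.univ ψ},
          eInt μ (eConj p C ψ.1) - ((∫ y, ψ.1 y ∂ν : ℝ) : EReal) := by
  have hp0 : 0 ≤ p := by linarith
  have hb := hbℓ.growthP hp0
  obtain ⟨ψ, f, hψ, hf, hfb, hψ0, hf0, hrep⟩ := exists_countable_representation hp μ
    (lowerSemicontinuous_shiftedCost hlsc haℓ_lsc hb) (shiftedCost_mix_le hp0 hb hconv hlb)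
  refine le_antisymm ?_ (iSup_le ?_)
  · generalize hS : (⨆ ψ : {ψ : Rd d → ℝ // (∃ φ : Rd d → ℝ, Cbp p φ ∧ ψ = fun y => φ y + bℓ y) ∧
        ConvexOn ℝ Set.univ ψ}, eInt μ (eConj p C ψ.1) - ((∫ y, ψ.1 y ∂ν : ℝ) : EReal)) = S
    have hle : ∀ φ : Rd d → ℝ, Cbp p φ → ConvexOn ℝ univ (fun y => φ y + bℓ y) →
        eInt μ (eConj p C fun y => φ y + bℓ y) - ((∫ y, (φ y + bℓ y) ∂ν : ℝ) : EReal) ≤ S := by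
      intro φ hφ hc
      rw [← hS]
      exact le_iSup (fun ψ : {ψ : Rd d → ℝ // (∃ φ : Rd d → ℝ, Cbp p φ ∧ ψ = fun y => φ y + bℓ y) ∧
        ConvexOn ℝ Set.univ ψ} => eInt μ (eConj p C ψ.1) - ((∫ y, ψ.1 y ∂ν : ℝ) : EReal))
        ⟨_, ⟨φ, hφ, rfl⟩, hc⟩
    have hSbot : S ≠ ⊥ := by
      have := hle (fun _ => 0) (cbp_const 0) (by simpa using hbℓ_conv)
      simp only [zero_add] at this
      exact ((bot_lt_eInt_eConj_sub haℓ_int hlb).trans_le this).ne'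
    induction S with
    | bot => exact absurd rfl hSbot
    | top => exact le_top
    | coe s =>
      have H := fun φ (hφ : Cbp p φ) F (hF : Integrable F μ) h =>
        integral_le_of_forall_dual_le hp hνp haℓ_int hbℓ hbℓ_conv hlb hmono hle hφ hF h
      have hD : 0 ≤ s + ∫ x, aℓ x ∂μ + ∫ y, bℓ y ∂ν := by
        simpa using H (fun _ => 0) (cbp_const 0) (fun _ => 0) (integrable_zero _ _ _)
          (Eventually.of_forall fun x ρ => by simp)
      have hrep_le : ∀ᵐ x ∂μ, ∀ (ρ : Pp p d) (k : ℕ),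
          ENNReal.ofReal (f k x - ∫ y, ψ k y ∂ρ.1) ≤ shiftedCost C aℓ bℓ x ρ := by
        filter_upwards [hrep] with x hx ρ k
        rw [hx]
        exact le_iSup (fun k => ENNReal.ofReal (f k x - ∫ y, ψ k y ∂ρ.1)) k
      obtain ⟨π, hπ, hπle⟩ := exists_coupling_lintegral_le hp0 hνp hψ hf hfb hψ0 hf0
        hrep_le H
      refine (iInf_le _ ⟨π, hπ⟩).trans ?_
      dsimp only
      rw [hπ.eInt_cost_eq hp0 hνp haℓ_int hb hψ hf hlb hrep]
      refine (add_le_add_left (EReal.coe_ennreal_le_coe_ennreal_iff.2 hπle) _).trans_eq ?_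
      rw [EReal.coe_ennreal_ofReal, max_eq_left hD, ← EReal.coe_add]
      congr 1
      ring
  · rintro ⟨_, ⟨φ, hφ, rfl⟩, -⟩
    exact le_iInf fun π => π.2.eInt_eConj_sub_le hp0 hνp haℓ_int hb hψ hf hlb hrep
      ((hφ.growthP hp0).add hb)
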